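/- There exists a function f : ℕ → ℝ with f(k)/k → 0 as k → ∞ such that for every integer k ≥ 2 and every finite simple graph G, the mod k chromatic index satisfies χ'_k(G) ≤ 9k + f(k). -/

import Mathlib

/-- The degree of vertex `v` in the colour class `i` of the edge-colouring `c` of `G`. -/
noncomputable def colorClassDegree {V : Type*} (G : SimpleGraph V) {n : ℕ}
    (c : G.edgeSet → Fin n) (i : Fin n) (v : V) : ℕ :=
  {u : V | ∃ h : G.Adj v u, c ⟨s(v, u), h⟩ = i}.ncard

/-- `c` is a `χ'_k`-colouring of `G`: in every colour class, every vertex of non-zero degree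
has degree congruent to `1` modulo `k`. -/
def IsModKColoring {V : Type*} (k : ℕ) (G : SimpleGraph V) {n : ℕ}
    (c : G.edgeSet → Fin n) : Prop :=
  ∀ (i : Fin n) (v : V),
    colorClassDegree G c i v ≠ 0 → colorClassDegree G c i v % k = 1

/-- The mod `k` chromatic index of `G`: the least number of colours in a `χ'_k`-colouring. -/
noncomputable def modChromaticIndex {V : Type*} (k : ℕ) (G : SimpleGraph V) : ℕ :=
  sInf {n : ℕ | ∃ c : G.edgeSet → Fin n, IsModKColoring k G c}

section Bipartite

open Finset Classical

theorem exists_perfectMatching_of_regular {E X Y : Type*} {F : Finset E} {l : E → X} {r : E → Y}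
    {m : ℕ} (hm : 0 < m) (hl : ∀ e ∈ F, #{e' ∈ F | l e' = l e} = m)
    (hr : ∀ e ∈ F, #{e' ∈ F | r e' = r e} = m) :
    ∃ M ⊆ F, (∀ e ∈ F, #{e' ∈ M | l e' = l e} = 1) ∧ ∀ e ∈ F, #{e' ∈ M | r e' = r e} = 1 := by
  have hl' : ∀ x ∈ F.image l, #{e ∈ F | l e = x} = m := by
    intro x hx
    obtain ⟨e, he, rfl⟩ := mem_image.1 hx
    exact hl e he
  have hr' : ∀ y ∈ F.image r, #{e ∈ F | r e = y} = m := by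
    intro x hx
    obtain ⟨e, he, rfl⟩ := mem_image.1 hx
    exact hr e he
  let t : {x // x ∈ F.image l} → Finset Y := fun x => (F.filter (l · = x)).image r
  have hall : ∀ s : Finset {x // x ∈ F.image l}, #s ≤ #(s.biUnion t) := by
    intro s
    let D := F.filter (l · ∈ s.image Subtype.val)
    have h1 : #D = m * #s := by
      have : ∀ e ∈ D, l e ∈ s.image Subtype.val := fun e he => (mem_filter.1 he).2
      rw [card_eq_sum_card_fiberwise (f := l) (t := s.image Subtype.val) this,
        sum_const_nat (m := m), card_image_of_injective _ Subtype.val_injective, mul_comm]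
      intro x hx
      obtain ⟨x', hx', rfl⟩ := mem_image.1 hx
      rw [← hl' x' x'.2]
      congr 1
      ext e
      simp only [D, mem_filter]
      constructor
      · tauto
      · rintro ⟨h, h'⟩
        exact ⟨⟨h, h' ▸ hx⟩, h'⟩
    have h2 : #D ≤ #(s.biUnion t) * m := by
      have : ∀ e ∈ D, r e ∈ s.biUnion t := by
        intro e he
        obtain ⟨he1, he2⟩ := mem_filter.1 he
        obtain ⟨x', hx', h⟩ := mem_image.1 he2
        exact mem_biUnion.2 ⟨x', hx', mem_image.2 ⟨e, mem_filter.2 ⟨he1, h.symm⟩, rfl⟩⟩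
      rw [card_eq_sum_card_fiberwise (f := r) (t := s.biUnion t) this]
      refine sum_le_card_nsmul _ _ _ fun y hy => ?_
      obtain ⟨x, -, hy⟩ := mem_biUnion.1 hy
      have hy' : y ∈ F.image r := image_subset_image (filter_subset _ _) hy
      rw [← hr' y hy']
      exact card_le_card (filter_subset_filter _ (filter_subset _ _))
    rw [h1, mul_comm] at h2
    exact Nat.le_of_mul_le_mul_right h2 hm
  obtain ⟨f, hf, hft⟩ := (Finset.all_card_le_biUnion_card_iff_exists_injective t).1 hall
  have hch : ∀ x : {x // x ∈ F.image l}, ∃ e ∈ F, l e = x ∧ r e = f x := by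
    intro x
    obtain ⟨e, he, h⟩ := mem_image.1 (hft x)
    exact ⟨e, (mem_filter.1 he).1, (mem_filter.1 he).2, h⟩
  choose g hgF hgl hgr using hch
  have hcard : #(F.image l) = #(F.image r) := by
    have h1 : #F = #(F.image l) * m := by
      rw [card_eq_sum_card_image l F, sum_const_nat hl']
    have h2 : #F = #(F.image r) * m := by
      rw [card_eq_sum_card_image r F, sum_const_nat hr']
    exact Nat.eq_of_mul_eq_mul_right hm (h1.symm.trans h2)
  have himg : univ.image f = F.image r := by
    apply eq_of_subset_of_card_le
    · intro y hy
      obtain ⟨x, -, rfl⟩ := mem_image.1 hy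
      exact mem_image.2 ⟨g x, hgF x, hgr x⟩
    · rw [card_image_of_injective _ hf, ← hcard, card_univ, Fintype.card_coe]
  refine ⟨univ.image g, ?_, ?_, ?_⟩
  · intro e he
    obtain ⟨x, -, rfl⟩ := mem_image.1 he
    exact hgF x
  · intro e he
    rw [card_eq_one]
    refine ⟨g ⟨l e, mem_image_of_mem l he⟩, ?_⟩
    ext e'
    simp only [mem_filter, mem_image, mem_univ, true_and, mem_singleton]
    constructor
    · rintro ⟨⟨x, rfl⟩, h⟩
      exact congrArg g (Subtype.ext ((hgl x).symm.trans h))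
    · rintro rfl
      exact ⟨⟨_, rfl⟩, hgl _⟩
  · intro e he
    have : r e ∈ univ.image f := himg ▸ mem_image_of_mem r he
    obtain ⟨x, -, hx⟩ := mem_image.1 this
    rw [card_eq_one]
    refine ⟨g x, ?_⟩
    ext e'
    simp only [mem_filter, mem_image, mem_univ, true_and, mem_singleton]
    constructor
    · rintro ⟨⟨x', rfl⟩, h⟩
      congr
      apply hf
      rw [hx, ← h, hgr]
    · rintro rfl
      exact ⟨⟨_, rfl⟩, by rw [hgr, hx]⟩

theorem card_sdiff_fibre {E Z : Type*} {p : E → Z} {m : ℕ} {F M : Finset E} (hMF : M ⊆ F)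
    (h1 : ∀ e ∈ F, #{e' ∈ F | p e' = p e} = m + 1)
    (h2 : ∀ e ∈ F, #{e' ∈ M | p e' = p e} = 1) :
    ∀ e ∈ F, #{e' ∈ F \ M | p e' = p e} = m := by
  intro e he
  have : {e' ∈ F \ M | p e' = p e} = {e' ∈ F | p e' = p e} \ {e' ∈ M | p e' = p e} := by
    ext; simp only [mem_filter, mem_sdiff]; tauto
  rw [this, card_sdiff_of_subset (filter_subset_filter _ hMF), h1 e he, h2 e he]
  rfl

theorem exists_regular_subset {E X Y : Type*} {l : E → X} {r : E → Y} {m : ℕ} {F : Finset E}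
    (hl : ∀ e ∈ F, #{e' ∈ F | l e' = l e} = m)
    (hr : ∀ e ∈ F, #{e' ∈ F | r e' = r e} = m) {j : ℕ} (hj : j ≤ m) :
    ∃ B ⊆ F, (∀ e ∈ F, #{e' ∈ B | l e' = l e} = j) ∧ ∀ e ∈ F, #{e' ∈ B | r e' = r e} = j := by
  induction m, hj using Nat.le_induction generalizing F with
  | base => exact ⟨F, Subset.rfl, hl, hr⟩
  | succ m hjm ih =>
    obtain ⟨M, hMF, hMl, hMr⟩ := exists_perfectMatching_of_regular m.succ_pos hl hr
    have kl := card_sdiff_fibre hMF hl hMl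
    have kr := card_sdiff_fibre hMF hr hMr
    rcases Nat.eq_zero_or_pos j with rfl | hj
    · exact ⟨∅, empty_subset _, by simp, by simp⟩
    have hm : 0 < m := by omega
    obtain ⟨B, hB, hBl, hBr⟩ := ih (fun e he => kl e (mem_sdiff.1 he).1)
      (fun e he => kr e (mem_sdiff.1 he).1)
    refine ⟨B, hB.trans sdiff_subset, fun e he => ?_, fun e he => ?_⟩
    · have := kl e he
      rw [← this] at hm
      obtain ⟨e', he'⟩ := card_pos.1 hm
      obtain ⟨h1, h2⟩ := mem_filter.1 he'
      rw [← h2]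
      exact hBl e' h1
    · have := kr e he
      rw [← this] at hm
      obtain ⟨e', he'⟩ := card_pos.1 hm
      obtain ⟨h1, h2⟩ := mem_filter.1 he'
      rw [← h2]
      exact hBr e' h1

theorem exists_fibre_split {E X : Type*} (F : Finset E) (l : E → X) {q : ℕ} (hq : 0 < q)
    (h : ∀ x, q ∣ #{e ∈ F | l e = x}) :
    ∃ l' : E → X × ℕ, (∀ e, (l' e).1 = l e) ∧ ∀ e ∈ F, #{e' ∈ F | l' e' = l' e} = q := by
  let idx : E → ℕ := fun e => if he : e ∈ ({e' ∈ F | l e' = l e} : Finset E) then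
    (({e' ∈ F | l e' = l e} : Finset E).equivFin ⟨e, he⟩ : ℕ) else 0
  refine ⟨fun e => (l e, idx e / q), fun _ => rfl, fun e he => ?_⟩
  obtain ⟨d, hd⟩ := h (l e)
  set S : Finset E := {e' ∈ F | l e' = l e} with hS
  have hidx : ∀ e' (he' : e' ∈ S), idx e' = S.equivFin ⟨e', he'⟩ := by
    intro e' he'
    have h1 : l e' = l e := (mem_filter.1 he').2
    have h2 : ({e'' ∈ F | l e'' = l e'} : Finset E) = S := by rw [h1]
    have h3 : ∀ T : Finset E, T = S → ∀ h4 : e' ∈ T,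
        (T.equivFin ⟨e', h4⟩ : ℕ) = S.equivFin ⟨e', he'⟩ := by
      rintro T rfl _
      rfl
    simp only [idx]
    rw [dif_pos (h2 ▸ he')]
    exact h3 _ h2 _
  have heS : e ∈ S := mem_filter.2 ⟨he, rfl⟩
  have hlt : idx e < q * d := by
    rw [hidx e heS, ← hd]
    exact Fin.is_lt _
  have hlt' : idx e / q < d := Nat.div_lt_of_lt_mul hlt
  have : #{e' ∈ F | (l e', idx e' / q) = (l e, idx e / q)} = #(Ico (q * (idx e / q)) (q * (idx e / q) + q)) := by
    refine card_bij (fun e' _ => idx e') ?_ ?_ ?_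
    · intro e' he'
      simp only [mem_filter, Prod.mk.injEq] at he'
      rw [mem_Ico, ← he'.2.2]
      have := Nat.div_add_mod (idx e') q
      have := Nat.mod_lt (idx e') hq
      omega
    · intro a ha b hb hab
      simp only [mem_filter, Prod.mk.injEq] at ha hb
      have ha' : a ∈ S := mem_filter.2 ⟨ha.1, ha.2.1⟩
      have hb' : b ∈ S := mem_filter.2 ⟨hb.1, hb.2.1⟩
      rw [hidx a ha', hidx b hb'] at hab
      simpa using S.equivFin.injective (Fin.ext hab)
    · intro n hn
      rw [mem_Ico] at hn
      have hnS : n < #S := by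
        rw [hd]
        have : q * (idx e / q + 1) ≤ q * d := Nat.mul_le_mul_left _ hlt'
        rw [mul_add, mul_one] at this
        omega
      obtain ⟨⟨e', he'⟩, he2⟩ := S.equivFin.surjective ⟨n, hnS⟩
      have h5 : idx e' = n := by rw [hidx e' he', he2]
      refine ⟨e', ?_, h5⟩
      rw [mem_filter, h5]
      refine ⟨(mem_filter.1 he').1, Prod.ext (mem_filter.1 he').2 ?_⟩
      exact Nat.div_eq_of_lt_le (by rw [mul_comm]; exact hn.1) (by rw [add_mul, one_mul, mul_comm]; exact hn.2)
  rw [this, Nat.card_Ico]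
  omega

theorem exists_subset_fibres_dvd {E X : Type*} {F : Finset E} (hF : F.Nonempty) {t h : E → X}
    {q k : ℕ} (hk : 0 < k) (hkq : k ≤ q) (ht : ∀ v, q ∣ #{e ∈ F | t e = v})
    (hh : ∀ v, q ∣ #{e ∈ F | h e = v}) :
    ∃ B ⊆ F, B.Nonempty ∧ (∀ v, k ∣ #{e ∈ B | t e = v}) ∧ ∀ v, k ∣ #{e ∈ B | h e = v} := by
  obtain ⟨t', ht1, ht2⟩ := exists_fibre_split F t (hk.trans_le hkq) ht
  obtain ⟨h', hh1, hh2⟩ := exists_fibre_split F h (hk.trans_le hkq) hh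
  obtain ⟨B, hBF, hB1, hB2⟩ : ∃ B ⊆ F, (∀ e ∈ F, #{e' ∈ B | t' e' = t' e} = k) ∧
      ∀ e ∈ F, #{e' ∈ B | h' e' = h' e} = k := by
    convert exists_regular_subset (l := t') (r := h') (by convert ht2) (by convert hh2) hkq
  have key : ∀ (p : E → X) (p' : E → X × ℕ), (∀ e, (p' e).1 = p e) →
      (∀ e ∈ F, #{e' ∈ B | p' e' = p' e} = k) → ∀ v, k ∣ #{e ∈ B | p e = v} := by
    intro p p' h1 h2 v
    rw [card_eq_sum_card_image p' (B.filter (p · = v))]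
    refine dvd_sum fun y hy => ?_
    obtain ⟨e, he, rfl⟩ := mem_image.1 hy
    obtain ⟨he1, he2⟩ := mem_filter.1 he
    rw [filter_filter]
    have : ({a ∈ B | p a = v ∧ p' a = p' e} : Finset E) = {a ∈ B | p' a = p' e} := by
      ext a
      simp only [mem_filter]
      constructor
      · tauto
      · rintro ⟨h3, h4⟩
        exact ⟨h3, by rw [← h1, h4, h1, he2], h4⟩
    rw [this, h2 e (hBF he1)]
  refine ⟨B, hBF, ?_, key t t' ht1 hB1, key h h' hh1 hB2⟩
  obtain ⟨e, he⟩ := hF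
  obtain ⟨e', he'⟩ := card_pos.1 (hk.trans_eq (hB1 e he).symm)
  exact ⟨e', (mem_filter.1 he').1⟩

end Bipartite

section ZeroSum

open Finset Classical MvPolynomial

theorem exists_nonzero_weighting {E V : Type*} (p₁ p₂ : E → V) (A : Finset E) (S : Finset V)
    (hS : ∀ e ∈ A, p₁ e ∈ S ∧ p₂ e ∈ S) {h : ℕ} (hh : 0 < h) [hq : Fact (2 * h + 1).Prime]
    (hcard : #S * (3 * h) < #A) :
    ∃ x : E → ZMod (2 * h + 1), (∃ e ∈ A, x e ≠ 0) ∧ (∀ v, ∑ e ∈ A,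
      ((if p₁ e = v then 1 else 0) + if p₂ e = v then 1 else 0) * x e ^ (2 * h) = 0) ∧
      ∀ v, ∑ e ∈ A, ((if p₁ e = v then 1 else 0) - if p₂ e = v then 1 else 0) * x e ^ h = 0 := by
  let K := ZMod (2 * h + 1)
  let f : V × Bool → MvPolynomial A K := fun i => if i.2 then
      ∑ e : A, C ((if p₁ e = i.1 then 1 else 0) + if p₂ e = i.1 then 1 else 0) * X e ^ (2 * h)
    else ∑ e : A, C ((if p₁ e = i.1 then 1 else 0) - if p₂ e = i.1 then 1 else 0) * X e ^ h
  have hdeg : ∀ (c : A → K) (n : ℕ), (∑ e : A, C (c e) * X e ^ n).totalDegree ≤ n := by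
    intro c n
    refine (totalDegree_finsetSum _ _).trans (Finset.sup_le fun e _ => ?_)
    refine (totalDegree_mul _ _).trans ?_
    rw [totalDegree_C, totalDegree_X_pow, zero_add]
  have hsum : ∑ i ∈ S ×ˢ univ, (f i).totalDegree < Fintype.card A := by
    rw [Fintype.card_coe]
    refine lt_of_le_of_lt ?_ hcard
    rw [sum_product]
    refine sum_le_card_nsmul _ _ _ fun v _ => ?_
    rw [Fintype.sum_bool]
    have h1 : (f (v, true)).totalDegree ≤ 2 * h := by
      simp only [f, if_true]
      exact hdeg _ _
    have h2 : (f (v, false)).totalDegree ≤ h := by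
      simp only [f, Bool.false_eq_true, if_false]
      exact hdeg _ _
    omega
  have hdvd : 2 * h + 1 ∣ Nat.card { x : A → K // ∀ i ∈ S ×ˢ univ, eval x (f i) = 0 } := by
    rw [Nat.card_eq_fintype_card]
    convert char_dvd_card_solutions_of_sum_lt (2 * h + 1) hsum
  have hzero : ∀ i ∈ S ×ˢ univ, eval 0 (f i) = 0 := by
    rintro ⟨v, b⟩ -
    cases b <;> simp [f, hh.ne']
  have h1 : 1 < Nat.card { x : A → K // ∀ i ∈ S ×ˢ univ, eval x (f i) = 0 } :=
    hq.out.one_lt.trans_le (Nat.le_of_dvd (Nat.card_pos_iff.2 ⟨⟨⟨0, hzero⟩⟩, inferInstance⟩) hdvd)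
  have := Finite.one_lt_card_iff_nontrivial.1 h1
  obtain ⟨⟨x, hx⟩, hx0⟩ := exists_ne (⟨0, hzero⟩ : { x : A → K // ∀ i ∈ S ×ˢ univ, eval x (f i) = 0 })
  have hx0' : x ≠ 0 := fun h => hx0 (Subtype.ext h)
  obtain ⟨e, he⟩ := Function.ne_iff.1 hx0'
  have hconv : ∀ (c : E → K) (n : ℕ), ∑ e ∈ A, c e * (if h : e ∈ A then x ⟨e, h⟩ else 0) ^ n =
      ∑ e : A, c e * x e ^ n := by
    intro c n
    rw [← sum_coe_sort A]
    refine sum_congr rfl fun e _ => ?_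
    rw [dif_pos e.2]
  refine ⟨fun e => if h : e ∈ A then x ⟨e, h⟩ else 0, ⟨e, e.2, ?_⟩, fun v => ?_, fun v => ?_⟩
  · simpa using he
  · by_cases hv : v ∈ S
    · have := hx (v, true) (by simp [hv])
      simp only [f, if_true, map_sum, map_mul, eval_C, map_pow, eval_X] at this
      rw [hconv, this]
    · refine sum_eq_zero fun e he => ?_
      rw [if_neg, if_neg]
      · simp
      · rintro rfl; exact hv (hS e he).2
      · rintro rfl; exact hv (hS e he).1
  · by_cases hv : v ∈ S
    · have := hx (v, false) (by simp [hv])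
      simp only [f, Bool.false_eq_true, if_false, map_sum, map_mul, eval_C, map_pow, eval_X] at this
      rw [hconv, this]
    · refine sum_eq_zero fun e he => ?_
      rw [if_neg, if_neg]
      · simp
      · rintro rfl; exact hv (hS e he).2
      · rintro rfl; exact hv (hS e he).1

theorem exists_subset_orientation {E V : Type*} (p₁ p₂ : E → V) (A : Finset E) (S : Finset V)
    (hS : ∀ e ∈ A, p₁ e ∈ S ∧ p₂ e ∈ S) {h : ℕ} (hh : 0 < h) (hq : (2 * h + 1).Prime)
    (hcard : #S * (3 * h) < #A) :
    ∃ F ⊆ A, F.Nonempty ∧ ∃ s t : E → V,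
      (∀ e, (s e = p₁ e ∧ t e = p₂ e) ∨ (s e = p₂ e ∧ t e = p₁ e)) ∧
      (∀ v, 2 * h + 1 ∣ #{e ∈ F | s e = v}) ∧ ∀ v, 2 * h + 1 ∣ #{e ∈ F | t e = v} := by
  have := Fact.mk hq
  obtain ⟨x, ⟨e₀, he₀, hx₀⟩, hx1, hx2⟩ := exists_nonzero_weighting p₁ p₂ A S hS hh hcard
  let s : E → V := fun e => if x e ^ h = 1 then p₁ e else p₂ e
  let t : E → V := fun e => if x e ^ h = 1 then p₂ e else p₁ e
  let F := A.filter (x · ≠ 0)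
  have hx2h : ∀ e ∈ F, x e ^ (2 * h) = 1 := fun e he =>
    ZMod.pow_card_sub_one_eq_one (mem_filter.1 he).2
  have hpm : ∀ e ∈ F, x e ^ h ≠ 1 → x e ^ h = -1 := by
    intro e he hne
    have : (x e ^ h) ^ 2 = 1 := by
      rw [← pow_mul, mul_comm h 2]
      exact hx2h e he
    exact (sq_eq_one_iff.1 this).resolve_left hne
  have hF : ∀ (c : E → ZMod (2 * h + 1)) (n : ℕ), 0 < n →
      ∑ e ∈ A, c e * x e ^ n = ∑ e ∈ F, c e * x e ^ n := by
    intro c n hn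
    refine (sum_subset (filter_subset _ _) fun e he hne => ?_).symm
    have : x e = 0 := by
      by_contra hx
      exact hne (mem_filter.2 ⟨he, hx⟩)
    rw [this, zero_pow hn.ne', mul_zero]
  have hadd : ∀ v, ((#{e ∈ F | s e = v} : ℕ) : ZMod (2 * h + 1)) + (#{e ∈ F | t e = v} : ℕ) = 0 := by
    intro v
    rw [natCast_card_filter, natCast_card_filter, ← sum_add_distrib]
    refine Eq.trans ?_ (hx1 v)
    rw [hF _ _ (by omega)]
    refine sum_congr rfl fun e he => ?_
    rw [hx2h e he, mul_one]
    simp only [s, t]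
    by_cases h1 : x e ^ h = 1
    · simp only [h1, if_true]
    · simp only [h1, if_false]
      exact add_comm _ _
  have hsub : ∀ v, ((#{e ∈ F | s e = v} : ℕ) : ZMod (2 * h + 1)) - (#{e ∈ F | t e = v} : ℕ) = 0 := by
    intro v
    rw [natCast_card_filter, natCast_card_filter, ← sum_sub_distrib]
    refine Eq.trans ?_ (hx2 v)
    rw [hF _ _ (by omega)]
    refine sum_congr rfl fun e he => ?_
    simp only [s, t]
    by_cases h1 : x e ^ h = 1
    · simp only [h1, if_true, mul_one]
    · simp only [h1, if_false]
      rw [hpm e he h1]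
      ring
  have h2 : (2 : ZMod (2 * h + 1)) ≠ 0 := by
    intro h0
    have : ((2 : ℕ) : ZMod (2 * h + 1)) = 0 := by exact_mod_cast h0
    rw [ZMod.natCast_eq_zero_iff] at this
    have := Nat.le_of_dvd (by norm_num) this
    omega
  refine ⟨F, filter_subset _ _, ⟨e₀, mem_filter.2 ⟨he₀, hx₀⟩⟩, s, t, fun e => ?_, fun v => ?_,
    fun v => ?_⟩
  · simp only [s, t]
    by_cases h1 : x e ^ h = 1
    · simp [h1]
    · simp [h1]
  · rw [← ZMod.natCast_eq_zero_iff]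
    refine (mul_eq_zero.1 ?_).resolve_left h2
    linear_combination hadd v + hsub v
  · rw [← ZMod.natCast_eq_zero_iff]
    refine (mul_eq_zero.1 ?_).resolve_left h2
    linear_combination hadd v - hsub v

/-- A dense enough multigraph has a non-empty set of edges with all degrees divisible by `k`. -/
theorem exists_subset_dvd_degree {E V : Type*} (p₁ p₂ : E → V) (A : Finset E) (S : Finset V)
    (hS : ∀ e ∈ A, p₁ e ∈ S ∧ p₂ e ∈ S) {h k : ℕ} (hh : 0 < h) (hq : (2 * h + 1).Prime)
    (hk : 0 < k) (hkq : k ≤ 2 * h + 1) (hcard : #S * (3 * h) < #A) :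
    ∃ B ⊆ A, B.Nonempty ∧ ∀ v, k ∣ #{e ∈ B | p₁ e = v} + #{e ∈ B | p₂ e = v} := by
  obtain ⟨F, hFA, hF, s, t, hst, hs, ht⟩ := exists_subset_orientation p₁ p₂ A S hS hh hq hcard
  obtain ⟨B, hBF, hB, hB1, hB2⟩ := exists_subset_fibres_dvd hF hk hkq hs ht
  refine ⟨B, hBF.trans hFA, hB, fun v => ?_⟩
  have : #{e ∈ B | p₁ e = v} + #{e ∈ B | p₂ e = v} = #{e ∈ B | s e = v} + #{e ∈ B | t e = v} := by
    simp only [card_filter, ← sum_add_distrib]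
    refine sum_congr rfl fun e _ => ?_
    rcases hst e with ⟨h1, h2⟩ | ⟨h1, h2⟩
    · rw [h1, h2]
    · rw [h1, h2, add_comm]
  rw [this]
  exact dvd_add (hB1 v) (hB2 v)

end ZeroSum

section ListColoring

open Finset Classical

theorem exists_injOn_of_card_le {X : Type*} {k : ℕ} (hk : 0 < k) (L : Finset X)
    (B : X → Finset ℕ) (hB : ∀ x ∈ L, k ≤ #(B x)) (hL : ∀ i, #{x ∈ L | i ∈ B x} ≤ k) :
    ∃ g : X → ℕ, (∀ x ∈ L, g x ∈ B x) ∧ Set.InjOn g L := by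
  have hall : ∀ s : Finset L, #s ≤ #(s.biUnion fun x => B x) := by
    intro s
    have h := sum_card_bipartiteAbove_eq_sum_card_bipartiteBelow (s := s)
      (t := s.biUnion fun x => B x) (fun x i => i ∈ B x.1)
    have h1 : #s * k ≤ ∑ a ∈ s, #(bipartiteAbove (fun (x : L) i => i ∈ B x.1) (s.biUnion fun x => B x) a) := by
      rw [← smul_eq_mul]
      refine card_nsmul_le_sum _ _ _ fun x hx => ?_
      refine (hB x x.2).trans (card_le_card fun i hi => ?_)
      rw [mem_bipartiteAbove]
      exact ⟨mem_biUnion.2 ⟨x, hx, hi⟩, hi⟩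
    have h2 : ∑ i ∈ s.biUnion (fun x => B x), #(bipartiteBelow (fun (x : L) i => i ∈ B x.1) s i) ≤
        #(s.biUnion fun x => B x) * k := by
      refine sum_le_card_nsmul _ _ _ fun i _ => ?_
      refine le_trans ?_ (hL i)
      refine card_le_card_of_injOn Subtype.val ?_ Subtype.val_injective.injOn
      intro x hx
      have hx := (mem_bipartiteBelow _).1 hx
      exact mem_filter.2 ⟨x.2, hx.2⟩
    exact Nat.le_of_mul_le_mul_right ((h1.trans_eq h).trans h2) hk
  obtain ⟨f, hf, hfB⟩ := (Finset.all_card_le_biUnion_card_iff_exists_injective fun x : L => B x).1 hall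
  refine ⟨fun x => if h : x ∈ L then f ⟨x, h⟩ else 0, fun x hx => ?_, fun x hx y hy hxy => ?_⟩
  · simpa [hx] using hfB ⟨x, hx⟩
  · have hx : x ∈ L := hx
    have hy : y ∈ L := hy
    simp only [dif_pos hx, dif_pos hy] at hxy
    simpa using hf hxy

theorem exists_light_subset {X : Type*} (T : Finset X) (w : X → ℕ) {t : ℕ} (ht : 2 * t ≤ #T) :
    ∃ K ⊆ T, #K = t ∧ ∑ x ∈ K, w x ≤ ∑ x ∈ T \ K, w x := by
  obtain ⟨K, hK, hmin⟩ := exists_min_image (T.powersetCard t) (fun K => ∑ x ∈ K, w x)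
    (powersetCard_nonempty.2 (by omega))
  obtain ⟨hKT, hKt⟩ := mem_powersetCard.1 hK
  obtain ⟨K', hK', hK't⟩ := exists_subset_card_eq (s := T \ K) (n := t) (by
    rw [card_sdiff_of_subset hKT]; omega)
  exact ⟨K, hKT, hKt, (hmin K' (mem_powersetCard.2 ⟨hK'.trans sdiff_subset, hK't⟩)).trans
    (sum_le_sum_of_subset hK')⟩

theorem exists_mod_coloring_aux {X : Type*} {k C d : ℕ} (hk : 2 ≤ k) (hC : k * C + 1 < 2 ^ (d + 1))
    (A : X → Finset ℕ) (n : ℕ) : ∀ (P : Finset ℕ) (L : Finset X), P ⊆ range C →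
      #(range C \ P) = n → (∀ x ∈ L, A x ⊆ range C ∧ k + d ≤ #(A x)) →
      ∑ x ∈ L, (2 ^ #(A x ∩ P) - 1) ≤ (k - 1) * #P →
      ∃ g : X → ℕ, (∀ x ∈ L, g x ∈ A x \ P) ∧
        ∀ i, #{x ∈ L | g x = i} = 0 ∨ #{x ∈ L | g x = i} % k = 1 := by
  induction n with
  | zero =>
    intro P L hP hn hA hpot
    have hPC : P = range C := by
      rw [card_eq_zero, sdiff_eq_empty_iff_subset] at hn
      exact hP.antisymm hn
    have hL : L = ∅ := by
      refine eq_empty_of_forall_notMem fun x hx => ?_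
      have h1 := (single_le_sum (f := fun x => 2 ^ #(A x ∩ P) - 1) (fun _ _ => Nat.zero_le _) hx).trans hpot
      have h2 : A x ∩ P = A x := inter_eq_left.2 (hPC ▸ (hA x hx).1)
      simp only [h2] at h1
      have h3 : 2 ^ (d + 1) ≤ 2 ^ #(A x) := Nat.pow_le_pow_right (by norm_num) (by
        have := (hA x hx).2; omega)
      rw [hPC, card_range] at h1
      have h4 : (k - 1) * C ≤ k * C := Nat.mul_le_mul_right _ (by omega)
      omega
    subst hL
    exact ⟨fun _ => 0, by simp, by simp⟩
  | succ n ih =>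
    intro P L hP hn hA hpot
    by_cases hex : ∃ i ∈ range C \ P, k < #{x ∈ L | i ∈ A x}
    · obtain ⟨i, hi, hN⟩ := hex
      obtain ⟨hiC, hiP⟩ := mem_sdiff.1 hi
      set T : Finset X := {x ∈ L | i ∈ A x} with hT
      have hmod : (#T - 1) % k < k := Nat.mod_lt _ (by omega)
      have hdiv := Nat.div_add_mod (#T - 1) k
      have hq : 1 ≤ (#T - 1) / k := (Nat.one_le_div_iff (by omega)).2 (by omega)
      have hq' : k * 1 ≤ k * ((#T - 1) / k) := Nat.mul_le_mul_left _ hq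
      obtain ⟨K, hKT, hKt, hKw⟩ := exists_light_subset T (fun x => 2 ^ #(A x ∩ P) - 1)
        (t := (#T - 1) % k) (by omega)
      have hTL : T ⊆ L := filter_subset _ _
      have hL' : L \ (T \ K) ⊆ L := sdiff_subset
      obtain ⟨g, hg, hgc⟩ := ih (insert i P) (L \ (T \ K)) (insert_subset hiC hP) (by
          rw [sdiff_insert, card_erase_of_mem hi, hn]; rfl) (fun x hx => hA x (hL' hx)) (by
          have hsplit : L \ (T \ K) = (L \ T) ∪ K := by
            ext x; simp only [mem_sdiff, mem_union]
            constructor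
            · tauto
            · rintro (h | h)
              · tauto
              · exact ⟨hTL (hKT h), by tauto⟩
          have hdisj : Disjoint (L \ T) K := disjoint_left.2 fun x hx hx' =>
            (mem_sdiff.1 hx).2 (hKT hx')
          rw [hsplit, sum_union hdisj, card_insert_of_notMem hiP]
          have h1 : ∑ x ∈ L \ T, (2 ^ #(A x ∩ insert i P) - 1) = ∑ x ∈ L \ T, (2 ^ #(A x ∩ P) - 1) := by
            refine sum_congr rfl fun x hx => ?_
            obtain ⟨hx1, hx2⟩ := mem_sdiff.1 hx
            have : i ∉ A x := fun h => hx2 (mem_filter.2 ⟨hx1, h⟩)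
            rw [inter_insert_of_notMem this]
          have h2 : ∑ x ∈ K, (2 ^ #(A x ∩ insert i P) - 1) =
              ∑ x ∈ K, (2 ^ #(A x ∩ P) - 1) + ∑ x ∈ K, (2 ^ #(A x ∩ P) - 1) + #K := by
            rw [card_eq_sum_ones K, ← sum_add_distrib, ← sum_add_distrib]
            refine sum_congr rfl fun x hx => ?_
            have : i ∈ A x := (mem_filter.1 (hKT hx)).2
            rw [inter_insert_of_mem this, card_insert_of_notMem (fun h => hiP (mem_inter.1 h).2),
              pow_succ]
            have := Nat.one_le_two_pow (n := #(A x ∩ P))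
            omega
          have h3 := sum_sdiff (f := fun x => 2 ^ #(A x ∩ P) - 1) hTL
          have h4 := sum_sdiff (f := fun x => 2 ^ #(A x ∩ P) - 1) hKT
          rw [h1, h2, mul_add, mul_one]
          omega)
      refine ⟨fun x => if x ∈ T \ K then i else g x, fun x hx => ?_, fun j => ?_⟩
      · by_cases hxT : x ∈ T \ K
        · simp only [hxT, if_true]
          exact mem_sdiff.2 ⟨(mem_filter.1 (mem_sdiff.1 hxT).1).2, hiP⟩
        · simp only [hxT, if_false]
          have := hg x (mem_sdiff.2 ⟨hx, hxT⟩)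
          rw [mem_sdiff] at this ⊢
          exact ⟨this.1, fun h => this.2 (mem_insert_of_mem h)⟩
      · by_cases hji : j = i
        · subst hji
          right
          have : ({x ∈ L | (if x ∈ T \ K then j else g x) = j} : Finset X) = T \ K := by
            ext x
            rw [mem_filter]
            constructor
            · rintro ⟨hx, h⟩
              by_contra hxT
              rw [if_neg hxT] at h
              exact (mem_sdiff.1 (hg x (mem_sdiff.2 ⟨hx, hxT⟩))).2 (h ▸ mem_insert_self _ _)
            · intro h
              exact ⟨hTL (mem_sdiff.1 h).1, if_pos h⟩
          rw [this, card_sdiff_of_subset hKT, hKt]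
          have : #T - (#T - 1) % k = 1 + k * ((#T - 1) / k) := by omega
          rw [this, Nat.add_mul_mod_self_left, Nat.mod_eq_of_lt (by omega)]
        · have : ({x ∈ L | (if x ∈ T \ K then i else g x) = j} : Finset X) =
              ({x ∈ L \ (T \ K) | g x = j} : Finset X) := by
            ext x
            rw [mem_filter, mem_filter, mem_sdiff (s := L)]
            by_cases hxT : x ∈ T \ K
            · rw [if_pos hxT]
              constructor
              · rintro ⟨-, h⟩; exact absurd h.symm hji
              · rintro ⟨h, -⟩; exact absurd hxT h.2
            · rw [if_neg hxT]; tauto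
          rw [this]
          exact hgc j
    · push Not at hex
      obtain ⟨g, hg, hinj⟩ := exists_injOn_of_card_le (k := k) (by omega) L (fun x => A x \ P) (by
          intro x hx
          have h1 := (single_le_sum (f := fun x => 2 ^ #(A x ∩ P) - 1) (fun _ _ => Nat.zero_le _) hx).trans hpot
          have h5 : #(A x ∩ P) < d + 1 := by
            rw [← Nat.pow_lt_pow_iff_right (a := 2) (by norm_num)]
            have h4 : (k - 1) * #P ≤ k * C := Nat.mul_le_mul (by omega) (by
              simpa using card_le_card hP)
            omega
          have h6 := card_sdiff_add_card_inter (A x) P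
          have h7 := (hA x hx).2
          omega) (by
          intro i
          by_cases hi : i ∈ range C \ P
          · refine le_trans (card_le_card fun x hx => ?_) (hex i hi)
            rw [mem_filter, mem_sdiff] at hx
            exact mem_filter.2 ⟨hx.1, hx.2.1⟩
          · rw [card_eq_zero.2]
            · omega
            · refine eq_empty_of_forall_notMem fun x hx => hi ?_
              rw [mem_filter, mem_sdiff] at hx
              exact mem_sdiff.2 ⟨(hA x hx.1).1 hx.2.1, hx.2.2⟩)
      refine ⟨g, hg, fun i => ?_⟩
      have : #{x ∈ L | g x = i} ≤ 1 := by
        rw [card_le_one]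
        intro a ha b hb
        rw [mem_filter] at ha hb
        exact hinj ha.1 hb.1 (ha.2.trans hb.2.symm)
      rcases Nat.le_one_iff_eq_zero_or_eq_one.1 this with h | h
      · exact Or.inl h
      · right
        rw [h, Nat.mod_eq_of_lt (by omega)]

theorem exists_mod_coloring {X : Type*} {k C d : ℕ} (hk : 2 ≤ k) (hC : k * C + 1 < 2 ^ (d + 1))
    (A : X → Finset ℕ) (L : Finset X) (hA : ∀ x ∈ L, A x ⊆ range C ∧ k + d ≤ #(A x)) :
    ∃ g : X → ℕ, (∀ x ∈ L, g x ∈ A x) ∧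
      ∀ i, #{x ∈ L | g x = i} = 0 ∨ #{x ∈ L | g x = i} % k = 1 := by
  obtain ⟨g, hg, h⟩ := exists_mod_coloring_aux hk hC A _ ∅ L (empty_subset _) rfl hA (by simp)
  exact ⟨g, fun x hx => (mem_sdiff.1 (hg x hx)).1, h⟩

end ListColoring

section Greedy

open Finset Classical

theorem exists_greedy_coloring {V : Type*} {k C d D : ℕ} (hk : 2 ≤ k)
    (hC : k * C + 1 < 2 ^ (d + 1)) (hCD : 2 * D + k + d ≤ C + 1) {R : Finset (Sym2 V)}
    (hR : ∀ e ∈ R, ¬ e.IsDiag)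
    (hdeg : ∀ S : Finset V, S.Nonempty → ∃ v ∈ S, #{e ∈ R | v ∈ e ∧ ∀ u ∈ e, u ∈ S} ≤ D)
    (n : ℕ) : ∀ S : Finset V, #S = n → (∀ y ∉ S, #{e ∈ R | y ∈ e ∧ ∃ u ∈ e, u ∈ S} ≤ D) →
      ∃ c : Sym2 V → ℕ, (∀ e ∈ R, (∃ u ∈ e, u ∈ S) → c e < C) ∧
        (∀ v ∈ S, ∀ i, #{e ∈ R | v ∈ e ∧ c e = i} = 0 ∨ #{e ∈ R | v ∈ e ∧ c e = i} % k = 1) ∧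
        ∀ y ∉ S, Set.InjOn c {e | e ∈ R ∧ y ∈ e ∧ ∃ u ∈ e, u ∈ S} := by
  induction n with
  | zero =>
    intro S hS _
    rw [card_eq_zero] at hS
    subst hS
    exact ⟨fun _ => 0, by simp, by simp, by simp⟩
  | succ n ih =>
    intro S hS hback
    obtain ⟨v, hvS, hvD⟩ := hdeg S (card_pos.1 (by omega))
    set S' := S.erase v with hS'
    have hS'S : S' ⊆ S := erase_subset _ _
    have hvS' : v ∉ S' := notMem_erase _ _
    have hmem : ∀ u ∈ S, u ≠ v → u ∈ S' := fun u hu hne => mem_erase.2 ⟨hne, hu⟩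
    have hvback : #{e ∈ R | v ∈ e ∧ ∃ u ∈ e, u ∈ S'} ≤ D := by
      refine (card_le_card fun e he => ?_).trans hvD
      rw [mem_filter] at he ⊢
      obtain ⟨heR, hve, u, hue, huS⟩ := he
      refine ⟨heR, hve, fun w hw => ?_⟩
      have huv : u ≠ v := fun h => hvS' (h ▸ huS)
      obtain rfl : e = s(u, v) := (Sym2.mem_and_mem_iff huv).1 ⟨hue, hve⟩
      rcases Sym2.mem_iff.1 hw with rfl | rfl
      · exact hS'S huS
      · exact hvS
    obtain ⟨c, hcC, hcS, hcinj⟩ := ih S' (by rw [hS', card_erase_of_mem hvS, hS]; rfl) (by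
      intro y hy
      by_cases hyv : y = v
      · rw [hyv]; exact hvback
      · refine (card_le_card fun e he => ?_).trans (hback y fun h => hy (hmem y h hyv))
        rw [mem_filter] at he ⊢
        obtain ⟨heR, hve, u, hue, huS⟩ := he
        exact ⟨heR, hve, u, hue, hS'S huS⟩)
    let L : Finset (Sym2 V) := {e ∈ R | v ∈ e ∧ ∀ u ∈ e, u ∉ S'}
    have hLR : ∀ e ∈ L, e ∈ R := fun e he => (mem_filter.1 he).1
    have hLv : ∀ e ∈ L, v ∈ e := fun e he => (mem_filter.1 he).2.1
    have hLS : ∀ e ∈ L, ∀ u ∈ e, u ∉ S' := fun e he => (mem_filter.1 he).2.2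
    let Φ : Sym2 V → Finset ℕ := fun e =>
      ({e' ∈ R | (∃ u ∈ e', u ∈ S') ∧ ∃ u ∈ e', u ∈ e} : Finset (Sym2 V)).image c
    have hA : ∀ e ∈ L, range C \ Φ e ⊆ range C ∧ k + d ≤ #(range C \ Φ e) := by
      intro e he
      refine ⟨sdiff_subset, ?_⟩
      obtain ⟨y, hy⟩ := Sym2.mem_iff_exists.1 (hLv e he)
      have hvy : y ≠ v := by
        rintro rfl
        exact hR e (hLR e he) (by rw [hy]; exact Sym2.mk_isDiag_iff.2 rfl)
      have hyS : y ∉ S := fun h => hLS e he y (by rw [hy]; exact Sym2.mem_mk_right _ _) (hmem y h hvy)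
      have h1 : #{e ∈ R | y ∈ e ∧ ∃ u ∈ e, u ∈ S'} + 1 ≤ D := by
        refine le_trans ?_ (hback y hyS)
        rw [← card_insert_of_notMem (a := e)]
        · refine card_le_card fun e' he' => ?_
          rw [mem_insert, mem_filter] at he'
          rw [mem_filter]
          rcases he' with rfl | ⟨h1, h2, u, h3, h4⟩
          · exact ⟨hLR _ he, by rw [hy]; exact Sym2.mem_mk_right _ _, v, hLv _ he, hvS⟩
          · exact ⟨h1, h2, u, h3, hS'S h4⟩
        · rw [mem_filter]
          rintro ⟨-, -, u, hu, huS⟩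
          exact hLS e he u hu huS
      have h2 : #(Φ e) ≤ #{e ∈ R | v ∈ e ∧ ∃ u ∈ e, u ∈ S'} + #{e ∈ R | y ∈ e ∧ ∃ u ∈ e, u ∈ S'} := by
        refine card_image_le.trans ((card_le_card fun e' he' => ?_).trans (card_union_le _ _))
        rw [mem_filter] at he'
        obtain ⟨h2, h3, u, h4, h5⟩ := he'
        rw [hy] at h5
        rw [mem_union, mem_filter, mem_filter]
        rcases Sym2.mem_iff.1 h5 with rfl | rfl
        · exact Or.inl ⟨h2, h4, h3⟩
        · exact Or.inr ⟨h2, h4, h3⟩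
      have h3 := le_card_sdiff (Φ e) (range C)
      rw [card_range] at h3
      omega
    obtain ⟨g, hg, hgc⟩ := exists_mod_coloring hk hC (fun e => range C \ Φ e) L hA
    have hgΦ : ∀ e ∈ L, ∀ e' ∈ R, (∃ u ∈ e', u ∈ S') → (∃ u ∈ e', u ∈ e) → g e ≠ c e' := by
      intro e he e' he' h1 h2 h3
      exact (mem_sdiff.1 (hg e he)).2 (mem_image.2 ⟨e', mem_filter.2 ⟨he', h1, h2⟩, h3.symm⟩)
    have hnL : ∀ e ∈ R, (∃ u ∈ e, u ∈ S) → e ∉ L → ∃ u ∈ e, u ∈ S' := by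
      rintro e he ⟨u, hue, huS⟩ heL
      by_contra! h
      refine heL (mem_filter.2 ⟨he, ?_, h⟩)
      by_contra hve
      exact h u hue (hmem u huS fun huv => hve (huv ▸ hue))
    have hnL' : ∀ e, (∃ u ∈ e, u ∈ S') → e ∉ L := by
      rintro e ⟨u, hue, huS⟩ heL
      exact hLS e heL u hue huS
    refine ⟨fun e => if e ∈ L then g e else c e, fun e he heS => ?_, fun u hu i => ?_,
      fun y hy e he e' he' hee' => ?_⟩
    · by_cases heL : e ∈ L
      · simp only [heL, if_true]
        exact mem_range.1 (mem_sdiff.1 (hg e heL)).1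
      · simp only [heL, if_false]
        exact hcC e he (hnL e he heS heL)
    · by_cases huv : u = v
      · subst huv
        by_cases hi : ∃ b ∈ R, u ∈ b ∧ (∃ w ∈ b, w ∈ S') ∧ c b = i
        · obtain ⟨b, hbR, hub, hbS, hbi⟩ := hi
          right
          have : ({e ∈ R | u ∈ e ∧ (if e ∈ L then g e else c e) = i} : Finset (Sym2 V)) = {b} := by
            ext e
            rw [mem_filter, mem_singleton]
            constructor
            · rintro ⟨heR, hue, hei⟩
              by_cases heL : e ∈ L
              · rw [if_pos heL] at hei
                exact absurd (hei.trans hbi.symm) (hgΦ e heL b hbR hbS ⟨u, hub, hue⟩)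
              · rw [if_neg heL] at hei
                exact hcinj u hvS' ⟨heR, hue, hnL e heR ⟨u, hue, hu⟩ heL⟩ ⟨hbR, hub, hbS⟩
                  (hei.trans hbi.symm)
            · rintro rfl
              exact ⟨hbR, hub, by rw [if_neg (hnL' e hbS), hbi]⟩
          rw [this, card_singleton, Nat.mod_eq_of_lt (by omega)]
        · have : ({e ∈ R | u ∈ e ∧ (if e ∈ L then g e else c e) = i} : Finset (Sym2 V)) =
              {e ∈ L | g e = i} := by
            ext e
            rw [mem_filter, mem_filter (s := L)]
            constructor
            · rintro ⟨heR, hue, hei⟩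
              by_cases heL : e ∈ L
              · rw [if_pos heL] at hei
                exact ⟨heL, hei⟩
              · rw [if_neg heL] at hei
                exact absurd ⟨e, heR, hue, hnL e heR ⟨u, hue, hu⟩ heL, hei⟩ hi
            · rintro ⟨heL, hei⟩
              exact ⟨hLR e heL, hLv e heL, by rw [if_pos heL, hei]⟩
          rw [this]
          exact hgc i
      · have huS' := hmem u hu huv
        have : ({e ∈ R | u ∈ e ∧ (if e ∈ L then g e else c e) = i} : Finset (Sym2 V)) =
            {e ∈ R | u ∈ e ∧ c e = i} := by
          refine filter_congr fun e _ => and_congr_right fun hue => ?_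
          rw [if_neg (hnL' e ⟨u, hue, huS'⟩)]
        rw [this]
        exact hcS u huS' i
    · obtain ⟨heR, hye, heS⟩ := he
      obtain ⟨heR', hye', heS'⟩ := he'
      have hyS' : y ∉ S' := fun h => hy (hS'S h)
      have hyv : y ≠ v := fun h => hy (h ▸ hvS)
      simp only at hee'
      by_cases heL : e ∈ L <;> by_cases heL' : e' ∈ L
      · rw [(Sym2.mem_and_mem_iff hyv).1 ⟨hye, hLv e heL⟩,
          (Sym2.mem_and_mem_iff hyv).1 ⟨hye', hLv e' heL'⟩]
      · rw [if_pos heL, if_neg heL'] at hee'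
        exact absurd hee' (hgΦ e heL e' heR' (hnL e' heR' heS' heL') ⟨y, hye', hye⟩)
      · rw [if_neg heL, if_pos heL'] at hee'
        exact absurd hee'.symm (hgΦ e' heL' e heR (hnL e heR heS heL) ⟨y, hye, hye'⟩)
      · rw [if_neg heL, if_neg heL'] at hee'
        exact hcinj y hyS' ⟨heR, hye, hnL e heR heS heL⟩ ⟨heR', hye', hnL e' heR' heS' heL'⟩ hee'

end Greedy

section Extremal

open Finset Classical

theorem exists_subset_dvd_card_incident {V : Type*} {h k : ℕ} (hh : 0 < h)
    (hq : (2 * h + 1).Prime) (hk : 0 < k) (hkq : k ≤ 2 * h + 1) {A : Finset (Sym2 V)}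
    {S : Finset V} (hA : ∀ e ∈ A, ¬ e.IsDiag) (hS : ∀ e ∈ A, ∀ v ∈ e, v ∈ S)
    (hcard : #S * (3 * h) < #A) :
    ∃ B ⊆ A, B.Nonempty ∧ ∀ v, k ∣ #{e ∈ B | v ∈ e} := by
  have hp : ∀ e : Sym2 V, ∃ p : V × V, e = s(p.1, p.2) := fun e =>
    Sym2.inductionOn e fun a b => ⟨(a, b), rfl⟩
  choose p hp using hp
  have hmem : ∀ e v, v ∈ e ↔ v = (p e).1 ∨ v = (p e).2 := by
    intro e v
    conv_lhs => rw [hp e]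
    exact Sym2.mem_iff
  obtain ⟨B, hBA, hB, hdvd⟩ := exists_subset_dvd_degree (fun e => (p e).1) (fun e => (p e).2) A S
    (fun e he => ⟨hS e he _ ((hmem e _).2 (Or.inl rfl)), hS e he _ ((hmem e _).2 (Or.inr rfl))⟩)
    hh hq hk hkq hcard
  refine ⟨B, hBA, hB, fun v => ?_⟩
  convert hdvd v using 1
  simp only [card_filter, ← sum_add_distrib]
  refine sum_congr rfl fun e he => ?_
  have hne : (p e).1 ≠ (p e).2 := fun h => hA e (hBA he) (by
    rw [hp e]; exact Sym2.mk_isDiag_iff.2 h)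
  have hiff := hmem e v
  by_cases h1 : (p e).1 = v
  · have h2 : ¬ (p e).2 = v := fun h => hne (h1.trans h.symm)
    simp [hiff, h1, h2]
  · by_cases h2 : (p e).2 = v
    · simp [hiff, h1, h2]
    · simp [hiff, h1, h2, Ne.symm h1, Ne.symm h2]

theorem sum_card_incident_le {V : Type*} (A : Finset (Sym2 V)) (S : Finset V) :
    ∑ v ∈ S, #{e ∈ A | v ∈ e} ≤ #A * 2 := by
  have h := sum_card_bipartiteAbove_eq_sum_card_bipartiteBelow (s := S) (t := A)
    (fun (v : V) (e : Sym2 V) => v ∈ e)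
  refine (le_of_eq h).trans (sum_le_card_nsmul _ _ _ fun e _ => ?_)
  induction e using Sym2.inductionOn with
  | _ a b =>
    refine (card_le_card (t := {a, b}) fun v hv => ?_).trans card_le_two
    have := ((mem_bipartiteBelow _).1 hv).2
    simpa using this

theorem exists_maximal_mod_subgraph {V : Type*} {h k : ℕ} (hh : 0 < h)
    (hq : (2 * h + 1).Prime) (hk : 2 ≤ k) (hkq : k ≤ 2 * h + 1) {E : Finset (Sym2 V)}
    (hE : ∀ e ∈ E, ¬ e.IsDiag) :
    ∃ H ⊆ E, (∀ v, #{e ∈ H | v ∈ e} = 0 ∨ #{e ∈ H | v ∈ e} % k = 1) ∧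
      ∀ S : Finset V, S.Nonempty →
        ∃ v ∈ S, #{e ∈ E \ H | v ∈ e ∧ ∀ u ∈ e, u ∈ S} ≤ 6 * h + (k - 1) := by
  obtain ⟨H, hH, hmax⟩ := exists_max_image
    (E.powerset.filter fun H => ∀ v, #{e ∈ H | v ∈ e} = 0 ∨ #{e ∈ H | v ∈ e} % k = 1) card
    ⟨∅, by simp⟩
  rw [mem_filter, mem_powerset] at hH
  obtain ⟨hHE, hH⟩ := hH
  have hmax' : ∀ A ⊆ E \ H, A.Nonempty → ¬ ∀ v, #{e ∈ H | v ∈ e} + #{e ∈ A | v ∈ e} = 0 ∨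
      (#{e ∈ H | v ∈ e} + #{e ∈ A | v ∈ e}) % k = 1 := by
    intro A hA hA0 hgood
    have hdisj : Disjoint H A := disjoint_left.2 fun e he he' => (mem_sdiff.1 (hA he')).2 he
    have := hmax (H ∪ A) (mem_filter.2 ⟨mem_powerset.2 (union_subset hHE (hA.trans sdiff_subset)),
      fun v => by
        rw [filter_union, card_union_of_disjoint (disjoint_filter_filter hdisj)]
        exact hgood v⟩)
    rw [card_union_of_disjoint hdisj] at this
    have := card_pos.2 hA0
    omega
  have hR : ∀ e ∈ E \ H, ¬ e.IsDiag := fun e he => hE e (mem_sdiff.1 he).1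
  let W : V → Prop := fun v => #{e ∈ H | v ∈ e} ≠ 0
  have hW1 : ∀ v, W v → #{e ∈ H | v ∈ e} % k = 1 := fun v hv => (hH v).resolve_left hv
  have hW0 : ∀ v, ¬ W v → #{e ∈ H | v ∈ e} = 0 := fun v hv => not_not.1 hv
  have hout : ∀ e ∈ E \ H, ∃ v ∈ e, W v := by
    intro e he
    by_contra! hno
    refine hmax' {e} (singleton_subset_iff.2 he) (singleton_nonempty _) fun v => ?_
    by_cases hv : v ∈ e
    · right
      rw [hW0 v (hno v hv), filter_singleton, if_pos hv, card_singleton, zero_add,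
        Nat.mod_eq_of_lt (by omega)]
    · rw [filter_singleton, if_neg hv, card_empty, add_zero]
      exact hH v
  have hcross : ∀ w, W w → #{e ∈ E \ H | w ∈ e ∧ ∃ u ∈ e, ¬ W u} ≤ k - 1 := by
    intro w hw
    by_contra! hlt
    obtain ⟨A, hA, hAk⟩ := exists_subset_card_eq (s := {e ∈ E \ H | w ∈ e ∧ ∃ u ∈ e, ¬ W u})
      (n := k) (by omega)
    have hA' : ∀ e ∈ A, w ∈ e ∧ ∃ u ∈ e, ¬ W u := fun e he => (mem_filter.1 (hA he)).2
    refine hmax' A (hA.trans (filter_subset _ _)) (card_pos.1 (by omega)) fun v => ?_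
    by_cases hvW : W v
    · right
      by_cases hvw : v = w
      · subst hvw
        rw [filter_true_of_mem fun e he => (hA' e he).1, hAk, Nat.add_mod_right]
        exact hW1 v hvW
      · rw [filter_false_of_mem (s := A), card_empty, add_zero]
        · exact hW1 v hvW
        · intro e he hve
          obtain ⟨hwe, u, hue, hu⟩ := hA' e he
          obtain rfl := (Sym2.mem_and_mem_iff hvw).1 ⟨hve, hwe⟩
          rcases Sym2.mem_iff.1 hue with rfl | rfl
          · exact hu hvW
          · exact hu hw
    · have hvw : v ≠ w := fun h => hvW (h ▸ hw)
      have : #{e ∈ A | v ∈ e} ≤ 1 := by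
        rw [card_le_one]
        intro a ha b hb
        rw [mem_filter] at ha hb
        rw [(Sym2.mem_and_mem_iff hvw).1 ⟨ha.2, (hA' a ha.1).1⟩,
          (Sym2.mem_and_mem_iff hvw).1 ⟨hb.2, (hA' b hb.1).1⟩]
      rw [hW0 v hvW, zero_add]
      rcases Nat.le_one_iff_eq_zero_or_eq_one.1 this with h | h
      · exact Or.inl h
      · right
        rw [h, Nat.mod_eq_of_lt (by omega)]
  refine ⟨H, hHE, hH, fun S hS => ?_⟩
  rcases (S.filter W).eq_empty_or_nonempty with hSW | hSW
  · obtain ⟨v, hv⟩ := hS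
    refine ⟨v, hv, ?_⟩
    rw [filter_false_of_mem, card_empty]
    · exact Nat.zero_le _
    · rintro e he ⟨-, heS⟩
      obtain ⟨u, hue, hu⟩ := hout e he
      have := filter_eq_empty_iff.1 hSW (heS u hue)
      exact this hu
  · set A : Finset (Sym2 V) := {e ∈ E \ H | ∀ u ∈ e, u ∈ S.filter W} with hAdef
    have hAsub : A ⊆ E \ H := filter_subset _ _
    have hAcard : #A ≤ #(S.filter W) * (3 * h) := by
      by_contra! hlt
      obtain ⟨B, hBA, hB, hdvd⟩ := exists_subset_dvd_card_incident hh hq (k := k) (by omega) hkq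
        (fun e he => hR e (hAsub he)) (fun e he => (mem_filter.1 he).2) hlt
      refine hmax' B (hBA.trans hAsub) hB fun v => ?_
      by_cases hv : W v
      · right
        obtain ⟨c, hc⟩ := hdvd v
        rw [hc, Nat.add_mul_mod_self_left]
        exact hW1 v hv
      · rw [filter_false_of_mem (s := B), card_empty, add_zero]
        · exact hH v
        · intro e he hve
          exact hv (mem_filter.1 ((mem_filter.1 (hBA he)).2 v hve)).2
    obtain ⟨v, hv, hvA⟩ : ∃ v ∈ S.filter W, #{e ∈ A | v ∈ e} ≤ 6 * h := by
      by_contra! hlt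
      have h1 := card_nsmul_le_sum (S.filter W) (fun v => #{e ∈ A | v ∈ e}) (6 * h + 1) hlt
      have h2 := h1.trans (sum_card_incident_le A _)
      rw [smul_eq_mul, mul_add, mul_one] at h2
      have := card_pos.2 hSW
      have h3 : #(S.filter W) * (6 * h) = #(S.filter W) * (3 * h) * 2 := by ring
      omega
    refine ⟨v, (mem_filter.1 hv).1, ?_⟩
    refine (card_le_card fun e he => ?_).trans ((card_union_le _ _).trans
      (add_le_add hvA (hcross v (mem_filter.1 hv).2)))
    rw [mem_filter] at he
    obtain ⟨heR, hve, heS⟩ := he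
    rw [mem_union, mem_filter, mem_filter, mem_filter]
    by_cases hex : ∃ u ∈ e, ¬ W u
    · exact Or.inr ⟨heR, hve, hex⟩
    · push Not at hex
      exact Or.inl ⟨⟨heR, fun u hu => mem_filter.2 ⟨heS u hu, hex u hu⟩⟩, hve⟩

end Extremal

section Index

open Finset Classical

theorem colorClassDegree_eq_card {V : Type*} [Fintype V] (G : SimpleGraph V) {n : ℕ}
    (c : Sym2 V → Fin n) (i : Fin n) (v : V) :
    colorClassDegree G (fun e => c e) i v = #{e ∈ G.edgeFinset | v ∈ e ∧ c e = i} := by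
  rw [← Set.ncard_coe_finset, colorClassDegree]
  rw [← Set.ncard_image_of_injective _ (f := fun u => s(v, u)) (fun a b hab => Sym2.congr_right.1 hab)]
  congr 1
  ext e
  simp only [Set.mem_image, Set.mem_ofPred_eq, coe_filter, SimpleGraph.mem_edgeFinset]
  constructor
  · rintro ⟨u, ⟨h, hc⟩, rfl⟩
    exact ⟨h, Sym2.mem_mk_left _ _, hc⟩
  · rintro ⟨he, hv, hc⟩
    obtain ⟨u, rfl⟩ := Sym2.mem_iff_exists.1 hv
    exact ⟨u, ⟨he, hc⟩, rfl⟩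

theorem modChromaticIndex_le {V : Type*} [Fintype V] (G : SimpleGraph V) {k h d C : ℕ}
    (hk : 2 ≤ k) (hh : 0 < h) (hq : (2 * h + 1).Prime) (hkq : k ≤ 2 * h + 1)
    (hCD : 2 * (6 * h + (k - 1)) + k + d ≤ C + 1) (hC : k * C + 1 < 2 ^ (d + 1)) :
    modChromaticIndex k G ≤ C + 1 := by
  have hE : ∀ e ∈ G.edgeFinset, ¬ e.IsDiag := fun e he =>
    G.not_isDiag_of_mem_edgeSet (SimpleGraph.mem_edgeFinset.1 he)
  obtain ⟨H, hHE, hH, hdeg⟩ := exists_maximal_mod_subgraph hh hq hk hkq hE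
  obtain ⟨c, hcC, hc, -⟩ := exists_greedy_coloring hk hC hCD
    (fun e he => hE e (mem_sdiff.1 he).1) hdeg _ univ rfl (by simp)
  have hcC' : ∀ e ∈ G.edgeFinset \ H, c e < C := fun e he => hcC e he
    ⟨_, e.out_fst_mem, mem_univ _⟩
  refine Nat.sInf_le ⟨fun e => if e.1 ∈ H then Fin.last C else Fin.ofNat (C + 1) (c e), ?_⟩
  intro i v
  rw [colorClassDegree_eq_card G (fun e => if e ∈ H then Fin.last C else Fin.ofNat (C + 1) (c e))]
  intro hne
  have hcast : ∀ e ∈ G.edgeFinset \ H, ((Fin.ofNat (C + 1) (c e) : Fin (C + 1)) : ℕ) = c e := by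
    intro e he
    rw [Fin.val_ofNat, Nat.mod_eq_of_lt ((hcC' e he).trans (Nat.lt_succ_self _))]
  by_cases hi : i = Fin.last C
  · have : ({e ∈ G.edgeFinset | v ∈ e ∧
        (if e ∈ H then Fin.last C else Fin.ofNat (C + 1) (c e)) = i} : Finset (Sym2 V)) =
        {e ∈ H | v ∈ e} := by
      ext e
      rw [mem_filter, mem_filter]
      constructor
      · rintro ⟨he, hv, hei⟩
        by_cases heH : e ∈ H
        · exact ⟨heH, hv⟩
        · rw [if_neg heH, hi] at hei
          have h1 := hcast e (mem_sdiff.2 ⟨he, heH⟩)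
          have h2 := hcC' e (mem_sdiff.2 ⟨he, heH⟩)
          rw [hei, Fin.val_last] at h1
          omega
      · rintro ⟨he, hv⟩
        exact ⟨hHE he, hv, by rw [if_pos he, hi]⟩
    rw [this] at hne ⊢
    exact (hH v).resolve_left hne
  · have : ({e ∈ G.edgeFinset | v ∈ e ∧
        (if e ∈ H then Fin.last C else Fin.ofNat (C + 1) (c e)) = i} : Finset (Sym2 V)) =
        {e ∈ G.edgeFinset \ H | v ∈ e ∧ c e = i} := by
      ext e
      rw [mem_filter, mem_filter]
      constructor
      · rintro ⟨he, hv, hei⟩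
        by_cases heH : e ∈ H
        · rw [if_pos heH] at hei
          exact absurd hei.symm hi
        · rw [if_neg heH] at hei
          have he' := mem_sdiff.2 ⟨he, heH⟩
          exact ⟨he', hv, by rw [← hei, hcast e he']⟩
      · rintro ⟨he, hv, hei⟩
        exact ⟨(mem_sdiff.1 he).1, hv, by
          rw [if_neg (mem_sdiff.1 he).2]
          exact Fin.ext ((hcast e he).trans hei)⟩
    rw [this] at hne ⊢
    exact (hc v (mem_univ v) i).resolve_left hne

end Index

section FejerKernel

open MeasureTheory

/-- The Fejér kernel, normalised to take the value `1` at the origin. -/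
noncomputable def fejerKernel (v : ℝ) : ℝ := 2 * ∫ r in (0 : ℝ)..1, (1 - r) * Real.cos (r * v)

theorem fejerKernel_mul_sq (v : ℝ) : fejerKernel v * v ^ 2 = 2 * (1 - Real.cos v) := by
  rcases eq_or_ne v 0 with rfl | hv
  · simp
  have hder : ∀ r ∈ Set.uIcc (0 : ℝ) 1,
      HasDerivAt (fun r : ℝ => (1 - r) * Real.sin (r * v) / v - Real.cos (r * v) / v ^ 2)
        ((1 - r) * Real.cos (r * v)) r := by
    intro r _
    have h1 : HasDerivAt (fun r : ℝ => r * v) v r := by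
      simpa using (hasDerivAt_id r).mul_const v
    have h2 : HasDerivAt (fun r : ℝ => 1 - r) (-1) r := by
      simpa using (hasDerivAt_id r).const_sub 1
    refine (((h2.mul h1.sin).div_const v).sub (h1.cos.div_const (v ^ 2))).congr_deriv ?_
    field_simp
    ring
  rw [fejerKernel, intervalIntegral.integral_eq_sub_of_hasDerivAt hder
    (Continuous.intervalIntegrable (by fun_prop) _ _)]
  simp
  field_simp
  ring

theorem abs_fejerKernel_le_one (v : ℝ) : |fejerKernel v| ≤ 1 := by
  have h : |∫ r in (0 : ℝ)..1, (1 - r) * Real.cos (r * v)| ≤ ∫ r in (0 : ℝ)..1, (1 - r) := by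
    refine (intervalIntegral.abs_integral_le_integral_abs zero_le_one).trans ?_
    refine intervalIntegral.integral_mono_on zero_le_one
      (Continuous.intervalIntegrable (by fun_prop) _ _)
      (Continuous.intervalIntegrable (by fun_prop) _ _) fun r hr => ?_
    rw [abs_mul, abs_of_nonneg (by linarith [hr.2] : (0 : ℝ) ≤ 1 - r)]
    exact mul_le_of_le_one_right (by linarith [hr.2]) (Real.abs_cos_le_one _)
  have h2 : ∫ r in (0 : ℝ)..1, (1 - r) = 1 / 2 := by
    rw [intervalIntegral.integral_sub (by simp) (by simp)]
    norm_num
  rw [fejerKernel, abs_mul, abs_two]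
  linarith

theorem fejerKernel_le_one (v : ℝ) : fejerKernel v ≤ 1 :=
  (le_abs_self _).trans (abs_fejerKernel_le_one v)

theorem fejerKernel_nonneg (v : ℝ) : 0 ≤ fejerKernel v := by
  rcases eq_or_ne v 0 with rfl | hv
  · rw [fejerKernel]
    refine mul_nonneg zero_le_two (intervalIntegral.integral_nonneg zero_le_one fun r hr => ?_)
    simpa using hr.2
  · refine nonneg_of_mul_nonneg_left ?_ (sq_pos_of_ne_zero hv)
    rw [fejerKernel_mul_sq]
    linarith [Real.cos_le_one v]

theorem half_le_fejerKernel {v : ℝ} (hv : |v| ≤ 1) : 1 / 2 ≤ fejerKernel v := by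
  have h : ∫ r in (0 : ℝ)..1, (1 - r) * (1 / 2) ≤ ∫ r in (0 : ℝ)..1, (1 - r) * Real.cos (r * v) := by
    refine intervalIntegral.integral_mono_on zero_le_one
      (Continuous.intervalIntegrable (by fun_prop) _ _)
      (Continuous.intervalIntegrable (by fun_prop) _ _) fun r hr => ?_
    refine mul_le_mul_of_nonneg_left ?_ (by linarith [hr.2])
    have h1 : (r * v) ^ 2 ≤ 1 := by
      rw [sq_le_one_iff_abs_le_one, abs_mul, abs_of_nonneg hr.1]
      exact mul_le_one₀ hr.2 (abs_nonneg v) hv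
    linarith [Real.one_sub_sq_div_two_le_cos (x := r * v)]
  have h2 : ∫ r in (0 : ℝ)..1, (1 - r) * (1 / 2) = 1 / 4 := by
    rw [intervalIntegral.integral_mul_const, intervalIntegral.integral_sub (by simp) (by simp)]
    norm_num
  rw [fejerKernel]
  linarith

theorem continuous_fejerKernel : Continuous fejerKernel := by
  unfold fejerKernel
  refine continuous_const.mul ?_
  exact intervalIntegral.continuous_parametric_intervalIntegral_of_continuous' (by fun_prop) _ _

theorem fejerKernel_le_inv (v : ℝ) : fejerKernel v ≤ 5 * (1 + v ^ 2)⁻¹ := by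
  rw [← div_eq_mul_inv, le_div_iff₀ (by positivity)]
  nlinarith [fejerKernel_le_one v, fejerKernel_mul_sq v, Real.neg_one_le_cos v]

theorem integrable_fejerKernel : Integrable fejerKernel :=
  (integrable_inv_one_add_sq.const_mul 5).mono' continuous_fejerKernel.aestronglyMeasurable
    (Filter.Eventually.of_forall fun v => by
      rw [Real.norm_of_nonneg (fejerKernel_nonneg v)]
      exact fejerKernel_le_inv v)

theorem four_le_add_sq_mul_fejerKernel (u : ℝ) :
    4 ≤ (|u| + Real.pi) ^ 2 * (fejerKernel u + fejerKernel (u + Real.pi)) := by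
  have h1 := fejerKernel_mul_sq u
  have h2 := fejerKernel_mul_sq (u + Real.pi)
  rw [Real.cos_add_pi] at h2
  have h3 : u ^ 2 ≤ (|u| + Real.pi) ^ 2 := by
    rw [← sq_abs u]
    exact pow_le_pow_left₀ (abs_nonneg u) (by linarith [Real.pi_pos]) 2
  have h4 : (u + Real.pi) ^ 2 ≤ (|u| + Real.pi) ^ 2 := by
    rw [← sq_abs (u + Real.pi)]
    refine pow_le_pow_left₀ (abs_nonneg _) ((abs_add_le _ _).trans ?_) 2
    rw [abs_of_pos Real.pi_pos]
  nlinarith [mul_le_mul_of_nonneg_right h3 (fejerKernel_nonneg u),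
    mul_le_mul_of_nonneg_right h4 (fejerKernel_nonneg (u + Real.pi))]

/-- Away from the origin, a concentrated kernel is dominated by translates of the unit kernel. -/
theorem fejerKernel_mul_le {T ε u : ℝ} (hT : 0 < T) (hε : 0 < ε) (hu : ε ≤ |u|) :
    T * fejerKernel (T * u) ≤
      (1 + Real.pi / ε) ^ 2 / T * (fejerKernel u + fejerKernel (u + Real.pi)) := by
  have hu0 : 0 < |u| := hε.trans_le hu
  have h1 := fejerKernel_mul_sq (T * u)
  have h2 := four_le_add_sq_mul_fejerKernel u
  have h3 : (|u| + Real.pi) ^ 2 ≤ (1 + Real.pi / ε) ^ 2 * u ^ 2 := by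
    rw [← sq_abs u, ← mul_pow]
    refine pow_le_pow_left₀ (by positivity) ?_ 2
    have : Real.pi ≤ Real.pi / ε * |u| := by
      rw [div_mul_eq_mul_div, le_div_iff₀ hε]
      exact mul_le_mul_of_nonneg_left hu Real.pi_pos.le
    linarith
  have hK : 0 ≤ fejerKernel u + fejerKernel (u + Real.pi) :=
    add_nonneg (fejerKernel_nonneg _) (fejerKernel_nonneg _)
  have hsq : 0 < u ^ 2 := by rw [← sq_abs]; positivity
  rw [div_mul_eq_mul_div, le_div_iff₀ hT]
  refine le_of_mul_le_mul_right ?_ hsq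
  calc T * fejerKernel (T * u) * T * u ^ 2 = fejerKernel (T * u) * (T * u) ^ 2 := by ring
    _ ≤ 4 := by rw [h1]; linarith [Real.neg_one_le_cos (T * u)]
    _ ≤ _ := h2
    _ ≤ _ := mul_le_mul_of_nonneg_right h3 hK
    _ = _ := by ring

end FejerKernel

section SmoothedChebyshev

open ArithmeticFunction

theorem residueClass_zmod_one (n : ℕ) : vonMangoldt.residueClass (1 : ZMod 1) n = Λ n := by
  simp [vonMangoldt.residueClass, Subsingleton.elim (n : ZMod 1) 1]

theorem exists_continuousOn_LSeries_vonMangoldt_eq :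
    ∃ F : ℂ → ℂ, ContinuousOn F {s | 1 ≤ s.re} ∧
      ∀ s : ℂ, 1 < s.re → LSeries (fun n => (Λ n : ℂ)) s = F s + 1 / (s - 1) := by
  refine ⟨vonMangoldt.LFunctionResidueClassAux (1 : ZMod 1),
    vonMangoldt.continuousOn_LFunctionResidueClassAux _, fun s hs => ?_⟩
  have h := vonMangoldt.eqOn_LFunctionResidueClassAux (isUnit_one (M := ZMod 1)) hs
  simp only [residueClass_zmod_one] at h
  rw [h]
  simp

theorem re_exp_mul_cpow (n : ℕ) (hn : n ≠ 0) (σ t X : ℝ) :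
    (Complex.exp (t * X * Complex.I) * (n : ℂ) ^ (-(σ + t * Complex.I))).re =
      (n : ℝ) ^ (-σ) * Real.cos (t * (X - Real.log n)) := by
  have hn' : (n : ℂ) ≠ 0 := Nat.cast_ne_zero.mpr hn
  rw [Complex.cpow_def_of_ne_zero hn', ← Complex.exp_add, ← Complex.natCast_log,
    Real.rpow_def_of_pos (by positivity), Complex.exp_re]
  congr 2
  · simp [-Complex.natCast_log]
  · simp [-Complex.natCast_log]
    ring

theorem hasSum_vonMangoldt_mul_fejerKernel {σ : ℝ} (hσ : 1 < σ) (T X : ℝ) :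
    HasSum (fun n : ℕ => Λ n * (n : ℝ) ^ (-σ) * fejerKernel (T * (X - Real.log n)))
      (2 * ∫ r in (0 : ℝ)..1, (1 - r) *
        (Complex.exp (↑(r * T) * X * Complex.I) *
          LSeries (fun n => (Λ n : ℂ)) (σ + ↑(r * T) * Complex.I)).re) := by
  have hsum : ∀ t : ℝ, HasSum (fun n : ℕ => Λ n * ((n : ℝ) ^ (-σ) * Real.cos (t * (X - Real.log n))))
      (Complex.exp (t * X * Complex.I) * LSeries (fun n => (Λ n : ℂ)) (σ + t * Complex.I)).re := by
    intro t
    have h := (LSeriesSummable_vonMangoldt (s := σ + t * Complex.I) (by simpa using hσ)).LSeriesHasSum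
    have h2 := Complex.hasSum_re (h.mul_left (Complex.exp (t * X * Complex.I)))
    convert h2 using 1
    funext n
    rcases eq_or_ne n 0 with rfl | hn
    · simp
    · rw [← re_exp_mul_cpow n hn, LSeries.term_of_ne_zero hn, div_eq_mul_inv, ← Complex.cpow_neg,
        mul_left_comm, Complex.re_ofReal_mul]
  have hsum0 : Summable fun n : ℕ => Λ n * (n : ℝ) ^ (-σ) := by
    simpa using (hsum 0).summable
  have key : HasSum (fun n : ℕ => ∫ r in (0 : ℝ)..1, (1 - r) *
        (Λ n * ((n : ℝ) ^ (-σ) * Real.cos ((r * T) * (X - Real.log n)))))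
      (∫ r in (0 : ℝ)..1, (1 - r) *
        (Complex.exp (↑(r * T) * X * Complex.I) *
          LSeries (fun n => (Λ n : ℂ)) (σ + ↑(r * T) * Complex.I)).re) := by
    refine intervalIntegral.hasSum_integral_of_dominated_convergence
      (fun n _ => Λ n * (n : ℝ) ^ (-σ)) (fun n => ?_) (fun n => ?_) ?_ ?_ ?_
    · exact Continuous.aestronglyMeasurable (by fun_prop)
    · refine Filter.Eventually.of_forall fun r hr => ?_
      rw [Set.uIoc_of_le zero_le_one] at hr
      have hΛ : 0 ≤ Λ n := vonMangoldt_nonneg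
      have hp : 0 ≤ (n : ℝ) ^ (-σ) := by positivity
      rw [Real.norm_eq_abs, abs_mul, abs_mul, abs_mul, abs_of_nonneg hΛ, abs_of_nonneg hp,
        abs_of_nonneg (by linarith [hr.2] : 0 ≤ 1 - r)]
      calc (1 - r) * (Λ n * ((n : ℝ) ^ (-σ) * |Real.cos (r * T * (X - Real.log n))|))
          ≤ 1 * (Λ n * ((n : ℝ) ^ (-σ) * 1)) := by
            gcongr
            · linarith [hr.1]
            · exact Real.abs_cos_le_one _
        _ = _ := by ring
    · exact Filter.Eventually.of_forall fun r _ => hsum0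
    · simp
    · exact Filter.Eventually.of_forall fun r _ => (hsum (r * T)).mul_left _
  refine (key.mul_left 2).congr_fun fun n => ?_
  have h : ∀ r : ℝ, (1 - r) * (Λ n * ((n : ℝ) ^ (-σ) * Real.cos ((r * T) * (X - Real.log n)))) =
      (Λ n * (n : ℝ) ^ (-σ)) * ((1 - r) * Real.cos (r * (T * (X - Real.log n)))) := by
    intro r
    rw [mul_assoc r T]
    ring
  simp_rw [h, intervalIntegral.integral_const_mul, fejerKernel]
  ring

end SmoothedChebyshev

section LaplaceTransform

open MeasureTheory Set

theorem integral_exp_mul_cos {η : ℝ} (hη : 0 < η) (t X : ℝ) :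
    ∫ u in Ioi (0 : ℝ), Real.exp (-η * u) * Real.cos (t * (X - u)) =
      (Complex.exp (t * X * Complex.I) * (1 / (η + t * Complex.I))).re := by
  have ha : (-(η + t * Complex.I) : ℂ).re < 0 := by simpa using hη
  have hint := integrableOn_exp_mul_complex_Ioi ha 0
  have h := integral_exp_mul_complex_Ioi ha 0
  have h1 : Complex.exp (t * X * Complex.I) * (1 / (η + t * Complex.I)) =
      ∫ u in Ioi (0 : ℝ), Complex.exp (t * X * Complex.I) *
        Complex.exp (-(η + t * Complex.I) * u) := by
    rw [integral_const_mul, h, neg_div_neg_eq]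
    simp
  rw [h1, ← RCLike.re_to_complex, ← integral_re (hint.const_mul _)]
  refine integral_congr_ae (Filter.Eventually.of_forall fun u => ?_)
  simp only [RCLike.re_to_complex]
  rw [← Complex.exp_add, Complex.exp_re]
  congr 2
  · simp
  · simp
    ring

theorem integral_exp_mul_fejerKernel {η : ℝ} (hη : 0 < η) (T X : ℝ) :
    ∫ u in Ioi (0 : ℝ), Real.exp (-η * u) * fejerKernel (T * (X - u)) =
      2 * ∫ r in (0 : ℝ)..1, (1 - r) *
        (Complex.exp (↑(r * T) * X * Complex.I) * (1 / (η + ↑(r * T) * Complex.I))).re := by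
  have hexp : Integrable (fun u => Real.exp (-η * u)) (volume.restrict (Ioi (0 : ℝ))) :=
    integrableOn_exp_mul_Ioi (by simpa using hη) 0
  have hint : Integrable (Function.uncurry fun r u : ℝ =>
      (1 - r) * (Real.exp (-η * u) * Real.cos ((r * T) * (X - u))))
      ((volume.restrict (uIoc (0 : ℝ) 1)).prod (volume.restrict (Ioi (0 : ℝ)))) := by
    have h1 : Integrable (fun r : ℝ => 1 - r) (volume.restrict (uIoc (0 : ℝ) 1)) :=
      intervalIntegrable_iff.mp (Continuous.intervalIntegrable (by fun_prop) 0 1)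
    refine (h1.mul_prod hexp).mono (Continuous.aestronglyMeasurable (by fun_prop))
      (Filter.Eventually.of_forall fun p => ?_)
    simp only [Function.uncurry, norm_mul]
    gcongr
    exact mul_le_of_le_one_right (norm_nonneg _) (Real.abs_cos_le_one _)
  have hswap := intervalIntegral_integral_swap hint
  simp_rw [integral_const_mul, integral_exp_mul_cos hη] at hswap
  rw [hswap, ← integral_const_mul]
  refine integral_congr_ae (Filter.Eventually.of_forall fun u => ?_)
  have h : ∀ r : ℝ, (1 - r) * (Real.exp (-η * u) * Real.cos ((r * T) * (X - u))) =
      Real.exp (-η * u) * ((1 - r) * Real.cos (r * (T * (X - u)))) := by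
    intro r
    rw [mul_assoc r T]
    ring
  simp only [h, intervalIntegral.integral_const_mul, fejerKernel]
  ring

theorem integrable_fejerKernel_comp {T : ℝ} (hT : T ≠ 0) (X : ℝ) :
    Integrable fun u : ℝ => fejerKernel (T * (X - u)) :=
  (integrable_fejerKernel.comp_mul_left' hT).comp_sub_left X

theorem integrableOn_exp_mul_fejerKernel {η : ℝ} (hη : 0 ≤ η) {T : ℝ} (hT : T ≠ 0) (X : ℝ) :
    IntegrableOn (fun u : ℝ => Real.exp (-η * u) * fejerKernel (T * (X - u))) (Ioi 0) := by
  refine (integrable_fejerKernel_comp hT X).integrableOn.mono'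
    (Continuous.aestronglyMeasurable (by have := continuous_fejerKernel; fun_prop)) ?_
  refine (ae_restrict_iff' measurableSet_Ioi).mpr (Filter.Eventually.of_forall fun u hu => ?_)
  rw [norm_mul, Real.norm_of_nonneg (Real.exp_pos _).le, Real.norm_of_nonneg (fejerKernel_nonneg _)]
  refine mul_le_of_le_one_left (fejerKernel_nonneg _) (Real.exp_le_one_iff.mpr ?_)
  have : 0 ≤ η * u := mul_nonneg hη (le_of_lt hu)
  linarith

theorem integral_exp_mul_fejerKernel_le {η : ℝ} (hη : 0 ≤ η) (X : ℝ) :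
    ∫ u in Ioi (0 : ℝ), Real.exp (-η * u) * fejerKernel (1 * (X - u)) ≤ ∫ u, fejerKernel u := by
  have hint := integrable_fejerKernel_comp one_ne_zero X
  calc ∫ u in Ioi (0 : ℝ), Real.exp (-η * u) * fejerKernel (1 * (X - u))
      ≤ ∫ u in Ioi (0 : ℝ), fejerKernel (1 * (X - u)) := by
        refine setIntegral_mono_on (integrableOn_exp_mul_fejerKernel hη one_ne_zero X)
          hint.integrableOn measurableSet_Ioi fun u hu => ?_
        refine mul_le_of_le_one_left (fejerKernel_nonneg _) (Real.exp_le_one_iff.mpr ?_)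
        have : 0 ≤ η * u := mul_nonneg hη (le_of_lt hu)
        linarith
    _ ≤ ∫ u, fejerKernel (1 * (X - u)) :=
        setIntegral_le_integral hint (Filter.Eventually.of_forall fun _ => fejerKernel_nonneg _)
    _ = ∫ u, fejerKernel u := by
        simp only [one_mul]
        exact integral_sub_left_eq_self _ _ _

theorem exp_le_integral_exp_mul_fejerKernel {η T X : ℝ} (hη : 0 ≤ η) (hT : 1 ≤ T) (hX : 1 ≤ X) :
    Real.exp (-η * (X + 1)) ≤
      T * ∫ u in Ioi (0 : ℝ), Real.exp (-η * u) * fejerKernel (T * (X - u)) := by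
  have hT0 : 0 < T := by linarith
  have hinv : T⁻¹ ≤ 1 := inv_le_one_of_one_le₀ hT
  have hinv0 : 0 < T⁻¹ := inv_pos.mpr hT0
  have hint := integrableOn_exp_mul_fejerKernel hη hT0.ne' X
  have hsub : Ioo (X - T⁻¹) (X + T⁻¹) ⊆ Ioi 0 := fun u hu => by
    simp only [mem_Ioi, mem_Ioo] at hu ⊢
    linarith
  have h1 : ∫ _u in Ioo (X - T⁻¹) (X + T⁻¹), Real.exp (-η * (X + 1)) * (1 / 2) ≤
      ∫ u in Ioo (X - T⁻¹) (X + T⁻¹), Real.exp (-η * u) * fejerKernel (T * (X - u)) := by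
    refine setIntegral_mono_on (integrableOn_const measure_Ioo_lt_top.ne)
      (hint.mono_set hsub) measurableSet_Ioo fun u hu => ?_
    have hexp : Real.exp (-η * (X + 1)) ≤ Real.exp (-η * u) := by
      refine Real.exp_le_exp.mpr ?_
      have : η * u ≤ η * (X + 1) := mul_le_mul_of_nonneg_left (by linarith [hu.2]) hη
      linarith
    refine mul_le_mul hexp (half_le_fejerKernel ?_) (by norm_num) (Real.exp_pos _).le
    rw [abs_mul, abs_of_pos hT0, ← le_inv_mul_iff₀ hT0, mul_one, abs_le]
    constructor <;> linarith [hu.1, hu.2]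
  have h2 : ∫ u in Ioo (X - T⁻¹) (X + T⁻¹), Real.exp (-η * u) * fejerKernel (T * (X - u)) ≤
      ∫ u in Ioi (0 : ℝ), Real.exp (-η * u) * fejerKernel (T * (X - u)) :=
    setIntegral_mono_set hint (Filter.Eventually.of_forall fun u =>
      mul_nonneg (Real.exp_pos _).le (fejerKernel_nonneg _)) hsub.eventuallyLE
  have h3 : ∫ _u in Ioo (X - T⁻¹) (X + T⁻¹), Real.exp (-η * (X + 1)) * (1 / 2) =
      T⁻¹ * Real.exp (-η * (X + 1)) := by
    rw [setIntegral_const, measureReal_def, Real.volume_Ioo, ENNReal.toReal_ofReal (by linarith),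
      smul_eq_mul]
    ring
  rw [h3] at h1
  rw [← inv_mul_le_iff₀ hT0]
  exact h1.trans h2

end LaplaceTransform

section BoundaryTerm

open MeasureTheory Set Filter Topology

/-- The contribution of the regular part `F` of a Dirichlet series to its Fejér-smoothed sum. -/
noncomputable def boundaryTerm (F : ℂ → ℂ) (T σ X : ℝ) : ℝ :=
  2 * ∫ r in (0 : ℝ)..1, (1 - r) *
    (Complex.exp (↑(r * T) * X * Complex.I) * F (σ + ↑(r * T) * Complex.I)).re

variable {F : ℂ → ℂ}

theorem continuous_vertical (hF : ContinuousOn F {s | 1 ≤ s.re}) (T : ℝ) {σ : ℝ} (hσ : 1 ≤ σ) :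
    Continuous fun r : ℝ => F (σ + ↑(r * T) * Complex.I) :=
  hF.comp_continuous (by fun_prop) fun r => by simpa using hσ

theorem exists_norm_vertical_le (hF : ContinuousOn F {s | 1 ≤ s.re}) (T : ℝ) :
    ∃ B : ℝ, ∀ σ ∈ Icc (1 : ℝ) 2, ∀ r ∈ Icc (0 : ℝ) 1, ‖F (σ + ↑(r * T) * Complex.I)‖ ≤ B := by
  have hcont : ContinuousOn (fun p : ℝ × ℝ => F (p.1 + ↑(p.2 * T) * Complex.I))
      (Icc (1 : ℝ) 2 ×ˢ Icc (0 : ℝ) 1) := by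
    refine hF.comp (Continuous.continuousOn (by fun_prop)) fun p hp => ?_
    simpa using hp.1.1
  obtain ⟨B, hB⟩ := (isCompact_Icc.prod isCompact_Icc).exists_bound_of_continuousOn hcont
  exact ⟨B, fun σ hσ r hr => hB (σ, r) ⟨hσ, hr⟩⟩

theorem abs_boundary_integrand_le {B : ℝ} (T X σ : ℝ) {r : ℝ} (hr : r ∈ Icc (0 : ℝ) 1)
    (hB : ‖F (σ + ↑(r * T) * Complex.I)‖ ≤ B) :
    |(1 - r) * (Complex.exp (↑(r * T) * X * Complex.I) * F (σ + ↑(r * T) * Complex.I)).re| ≤ B := by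
  rw [abs_mul, abs_of_nonneg (by linarith [hr.2] : 0 ≤ 1 - r)]
  refine (mul_le_of_le_one_left (abs_nonneg _) (by linarith [hr.1])).trans ?_
  refine (Complex.abs_re_le_norm _).trans ?_
  rw [norm_mul, ← Complex.ofReal_mul, Complex.norm_exp_ofReal_mul_I, one_mul]
  exact hB

theorem exists_abs_boundaryTerm_le (hF : ContinuousOn F {s | 1 ≤ s.re}) (T : ℝ) :
    ∃ B : ℝ, ∀ σ ∈ Icc (1 : ℝ) 2, ∀ X, |boundaryTerm F T σ X| ≤ B := by
  obtain ⟨B, hB⟩ := exists_norm_vertical_le hF T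
  refine ⟨2 * B, fun σ hσ X => ?_⟩
  rw [boundaryTerm, abs_mul, abs_two]
  have h := intervalIntegral.norm_integral_le_of_norm_le_const (a := (0 : ℝ)) (b := 1) (C := B)
    (f := fun r => (1 - r) *
      (Complex.exp (↑(r * T) * X * Complex.I) * F (σ + ↑(r * T) * Complex.I)).re) fun r hr => by
    rw [uIoc_of_le zero_le_one] at hr
    exact abs_boundary_integrand_le T X σ (Ioc_subset_Icc_self hr)
      (hB σ hσ r (Ioc_subset_Icc_self hr))
  simp only [sub_zero, abs_one, mul_one, Real.norm_eq_abs] at h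
  linarith

theorem tendsto_boundaryTerm_nhdsGT (hF : ContinuousOn F {s | 1 ≤ s.re}) (T X : ℝ) :
    Tendsto (fun σ => boundaryTerm F T σ X) (𝓝[>] 1) (𝓝 (boundaryTerm F T 1 X)) := by
  obtain ⟨B, hB⟩ := exists_norm_vertical_le hF T
  have hmem : ∀ᶠ σ : ℝ in 𝓝[>] 1, σ ∈ Ioc (1 : ℝ) 2 := Ioc_mem_nhdsGT one_lt_two
  refine Tendsto.const_mul 2 ?_
  refine intervalIntegral.tendsto_integral_filter_of_dominated_convergence (fun _ => B) ?_ ?_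
    (by simp) ?_
  · filter_upwards [hmem] with σ hσ
    exact (Continuous.mul (by fun_prop) (Complex.continuous_re.comp
      (Continuous.mul (by fun_prop) (continuous_vertical hF T hσ.1.le)))).aestronglyMeasurable
  · filter_upwards [hmem] with σ hσ
    refine Eventually.of_forall fun r hr => ?_
    rw [uIoc_of_le zero_le_one] at hr
    exact abs_boundary_integrand_le T X σ (Ioc_subset_Icc_self hr)
      (hB σ (Ioc_subset_Icc_self hσ) r (Ioc_subset_Icc_self hr))
  · refine Eventually.of_forall fun r _ => ?_
    have h : Tendsto (fun σ : ℝ => F (σ + ↑(r * T) * Complex.I)) (𝓝[>] 1)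
        (𝓝 (F ((1 : ℝ) + ↑(r * T) * Complex.I))) := by
      refine (hF _ (by simp)).tendsto.comp (tendsto_nhdsWithin_iff.mpr ⟨?_, ?_⟩)
      · exact ((Continuous.tendsto (by fun_prop) 1 :
          Tendsto (fun σ : ℝ => (σ + ↑(r * T) * Complex.I : ℂ)) (𝓝 1) _)).mono_left
          nhdsWithin_le_nhds
      · filter_upwards [hmem] with σ hσ
        simpa using hσ.1.le
    exact ((Complex.continuous_re.tendsto _).comp (h.const_mul _)).const_mul _

theorem tendsto_boundaryTerm_atTop (hF : ContinuousOn F {s | 1 ≤ s.re}) {T : ℝ} (hT : 0 < T) :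
    Tendsto (fun X => boundaryTerm F T 1 X) atTop (𝓝 0) := by
  set f : ℝ → ℂ := (Ioc (0 : ℝ) 1).indicator
    fun r => ((1 - r : ℝ) : ℂ) * F ((1 : ℝ) + ↑(r * T) * Complex.I) with hf
  have hlim : Tendsto (fun X : ℝ => -(T / (2 * Real.pi)) * X) atTop (cocompact ℝ) := by
    refine Tendsto.mono_right ?_ atBot_le_cocompact
    exact tendsto_id.const_mul_atTop_of_neg (by simpa using by positivity)
  have hRL := (Real.tendsto_integral_exp_smul_cocompact f).comp hlim
  have hre := (Complex.continuous_re.tendsto _).comp hRL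
  have h2 := hre.const_mul 2
  simp only [Complex.zero_re, mul_zero] at h2
  refine h2.congr fun X => ?_
  have hterm : ∀ r : ℝ, Real.fourierChar (-(r * (-(T / (2 * Real.pi)) * X))) • f r =
      (Ioc (0 : ℝ) 1).indicator (fun r => ((1 - r : ℝ) : ℂ) *
        (Complex.exp (↑(r * T) * X * Complex.I) * F ((1 : ℝ) + ↑(r * T) * Complex.I))) r := by
    intro r
    by_cases hr : r ∈ Ioc (0 : ℝ) 1
    · rw [hf, indicator_of_mem hr, indicator_of_mem hr, Circle.smul_def, Real.fourierChar_apply,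
        smul_eq_mul]
      have he : ((2 * Real.pi * -(r * (-(T / (2 * Real.pi)) * X)) : ℝ) : ℂ) * Complex.I =
          ↑(r * T) * X * Complex.I := by
        rw [← Complex.ofReal_mul]
        congr 2
        field_simp
      rw [he]
      ring
    · simp [hf, indicator_of_notMem hr]
  simp only [Function.comp_apply, boundaryTerm, hterm]
  rw [integral_indicator measurableSet_Ioc, intervalIntegral.integral_of_le zero_le_one,
    ← RCLike.re_to_complex, ← integral_re]
  · simp only [RCLike.re_to_complex, Complex.re_ofReal_mul]
  · exact (Continuous.mul (by fun_prop) (Continuous.mul (by fun_prop)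
      (continuous_vertical hF T le_rfl))).integrableOn_Icc.mono_set Ioc_subset_Icc_self

end BoundaryTerm

section ShortIntervals

open MeasureTheory Filter Topology ArithmeticFunction

variable {F : ℂ → ℂ}

theorem hasSum_vonMangoldt_mul_fejerKernel_eq (hF : ContinuousOn F {s | 1 ≤ s.re})
    (hL : ∀ s : ℂ, 1 < s.re → LSeries (fun n => (Λ n : ℂ)) s = F s + 1 / (s - 1)) {σ : ℝ} (hσ : 1 < σ)
    (T X : ℝ) :
    HasSum (fun n : ℕ => Λ n * (n : ℝ) ^ (-σ) * fejerKernel (T * (X - Real.log n)))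
      ((∫ u in Set.Ioi (0 : ℝ), Real.exp (-(σ - 1) * u) * fejerKernel (T * (X - u))) +
        boundaryTerm F T σ X) := by
  convert hasSum_vonMangoldt_mul_fejerKernel hσ T X using 1
  have hη : 0 < σ - 1 := sub_pos.mpr hσ
  have hne : ∀ r : ℝ, ((σ - 1 : ℝ) : ℂ) + ↑(r * T) * Complex.I ≠ 0 := fun r h => by
    have := congrArg Complex.re h
    simp at this
    linarith
  rw [integral_exp_mul_fejerKernel hη, boundaryTerm, ← mul_add, ← intervalIntegral.integral_add]
  · congr 1
    refine intervalIntegral.integral_congr fun r _ => ?_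
    rw [hL _ (by simpa using hσ), ← mul_add, ← Complex.add_re, ← mul_add, add_comm (F _)]
    congr 5
    push_cast
    ring
  · refine Continuous.intervalIntegrable (Continuous.mul (by fun_prop)
      (Complex.continuous_re.comp (Continuous.mul (by fun_prop) ?_))) _ _
    exact continuous_const.div (by fun_prop) hne
  · exact (Continuous.mul (by fun_prop) (Complex.continuous_re.comp
      (Continuous.mul (by fun_prop) (continuous_vertical hF T hσ.le)))).intervalIntegrable _ _

theorem exists_tsum_vonMangoldt_mul_fejerKernel_le (hF : ContinuousOn F {s | 1 ≤ s.re})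
    (hL : ∀ s : ℂ, 1 < s.re → LSeries (fun n => (Λ n : ℂ)) s = F s + 1 / (s - 1)) :
    ∃ M : ℝ, 0 ≤ M ∧ ∀ σ ∈ Set.Ioc (1 : ℝ) 2, ∀ X : ℝ,
      ∑' n : ℕ, Λ n * (n : ℝ) ^ (-σ) * fejerKernel (1 * (X - Real.log n)) ≤ M := by
  obtain ⟨B, hB⟩ := exists_abs_boundaryTerm_le hF 1
  refine ⟨max 0 ((∫ u, fejerKernel u) + B), le_max_left _ _, fun σ hσ X => le_max_of_le_right ?_⟩
  rw [(hasSum_vonMangoldt_mul_fejerKernel_eq hF hL hσ.1 1 X).tsum_eq]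
  exact add_le_add (integral_exp_mul_fejerKernel_le (by linarith [hσ.1]) X)
    ((le_abs_self _).trans (hB σ ⟨hσ.1.le, hσ.2⟩ X))

/-- The natural numbers whose logarithm is within `ε` of `X`. -/
noncomputable def natsNearExp (ε X : ℝ) : Finset ℕ :=
  (Finset.range (⌈Real.exp (X + ε)⌉₊ + 1)).filter fun n => |X - Real.log n| < ε

theorem mem_natsNearExp {ε X : ℝ} {n : ℕ} (hn : n ≠ 0) :
    n ∈ natsNearExp ε X ↔ |X - Real.log n| < ε := by
  rw [natsNearExp, Finset.mem_filter, Finset.mem_range, and_iff_right_iff_imp]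
  intro h
  have hpos : (0 : ℝ) < n := by positivity
  have h1 : (n : ℝ) ≤ Real.exp (X + ε) := by
    rw [← Real.log_le_iff_le_exp hpos]
    linarith [(abs_lt.mp h).1]
  exact Nat.lt_succ_of_le (Nat.cast_le.mp (h1.trans (Nat.le_ceil _)))

theorem vonMangoldt_smoothed_le {σ T ε M : ℝ} (hσ : 1 < σ) (hT : 0 < T) (hε : 0 < ε)
    (hF : ContinuousOn F {s | 1 ≤ s.re})
    (hL : ∀ s : ℂ, 1 < s.re → LSeries (fun n => (Λ n : ℂ)) s = F s + 1 / (s - 1))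
    (hM : ∀ X : ℝ, ∑' n : ℕ, Λ n * (n : ℝ) ^ (-σ) * fejerKernel (1 * (X - Real.log n)) ≤ M)
    (X : ℝ) :
    T * ∑' n : ℕ, Λ n * (n : ℝ) ^ (-σ) * fejerKernel (T * (X - Real.log n)) ≤
      T * ∑ n ∈ natsNearExp ε X, Λ n / n + (1 + Real.pi / ε) ^ 2 / T * (M + M) := by
  have hS := fun T X => (hasSum_vonMangoldt_mul_fejerKernel_eq hF hL hσ T X).summable
  have hnear : HasSum (fun n => if n ∈ natsNearExp ε X then Λ n / n else 0)
      (∑ n ∈ natsNearExp ε X, Λ n / n) := by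
    rw [Finset.sum_congr rfl fun n hn => (if_pos hn).symm]
    exact hasSum_sum_of_ne_finset_zero fun n hn => if_neg hn
  have hR := (hnear.mul_left T).add (((hS 1 X).hasSum.add (hS 1 (X + Real.pi)).hasSum).mul_left
    ((1 + Real.pi / ε) ^ 2 / T))
  refine (hasSum_le (fun n => ?_) ((hS T X).hasSum.mul_left T) hR).trans ?_
  · rcases eq_or_ne n 0 with rfl | hn
    · simp
    have hn1 : (1 : ℝ) ≤ n := by exact_mod_cast Nat.one_le_iff_ne_zero.mpr hn
    have hΛ : 0 ≤ Λ n := vonMangoldt_nonneg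
    have hp : 0 ≤ (n : ℝ) ^ (-σ) := by positivity
    have hK : 0 ≤ fejerKernel (X - Real.log n) + fejerKernel (X - Real.log n + Real.pi) :=
      add_nonneg (fejerKernel_nonneg _) (fejerKernel_nonneg _)
    have hX : X + Real.pi - Real.log n = X - Real.log n + Real.pi := by ring
    rw [← mul_add, one_mul, one_mul, hX]
    by_cases h : n ∈ natsNearExp ε X
    · rw [if_pos h]
      refine le_add_of_le_of_nonneg (mul_le_mul_of_nonneg_left ?_ hT.le) (by positivity)
      rw [div_eq_mul_inv]
      refine (mul_le_of_le_one_right (by positivity) (fejerKernel_le_one _)).trans ?_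
      refine mul_le_mul_of_nonneg_left ?_ hΛ
      rw [← Real.rpow_neg_one]
      exact Real.rpow_le_rpow_of_exponent_le hn1 (by linarith)
    · rw [if_neg h, mul_zero, zero_add]
      rw [mem_natsNearExp hn, not_lt] at h
      have h1 := mul_le_mul_of_nonneg_left (fejerKernel_mul_le hT hε h) (mul_nonneg hΛ hp)
      linarith
  · have hA : 0 ≤ (1 + Real.pi / ε) ^ 2 / T := by positivity
    exact add_le_add_right (mul_le_mul_of_nonneg_left (add_le_add (hM _) (hM _)) hA) _

/-- Logarithmic windows of fixed width carry a positive proportion of the weight `Λ n / n`. -/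
theorem exists_eventually_le_sum_vonMangoldt_div {ε : ℝ} (hε : 0 < ε) :
    ∃ c > 0, ∀ᶠ X in atTop, c ≤ ∑ n ∈ natsNearExp ε X, Λ n / n := by
  obtain ⟨F, hF, hL⟩ := exists_continuousOn_LSeries_vonMangoldt_eq
  obtain ⟨M, hM0, hM⟩ := exists_tsum_vonMangoldt_mul_fejerKernel_le hF hL
  set A := (1 + Real.pi / ε) ^ 2 * (M + M) with hA
  have hA0 : 0 ≤ A := by positivity
  set T := 1 + 4 * A with hTdef
  have hT : 1 ≤ T := by linarith
  have hT0 : 0 < T := by linarith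
  refine ⟨1 / (2 * T), by positivity, ?_⟩
  have hJ : ∀ᶠ X in atTop, |T * boundaryTerm F T 1 X| < 1 / 4 := by
    have h := ((tendsto_boundaryTerm_atTop hF hT0).const_mul T).abs
    rw [mul_zero, abs_zero] at h
    exact h.eventually_lt_const (by norm_num)
  filter_upwards [hJ, eventually_ge_atTop 1] with X hX hX1
  have hle : ∀ᶠ σ : ℝ in 𝓝[>] 1, Real.exp (-(σ - 1) * (X + 1)) + T * boundaryTerm F T σ X ≤
      T * ∑ n ∈ natsNearExp ε X, Λ n / n + A / T := by
    filter_upwards [Ioc_mem_nhdsGT one_lt_two] with σ hσ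
    have h1 := vonMangoldt_smoothed_le hσ.1 hT0 hε hF hL (hM σ hσ) X
    rw [(hasSum_vonMangoldt_mul_fejerKernel_eq hF hL hσ.1 T X).tsum_eq, mul_add] at h1
    have h2 := exp_le_integral_exp_mul_fejerKernel (sub_nonneg.mpr hσ.1.le) hT hX1
    rw [div_mul_eq_mul_div] at h1
    linarith
  have hlim : Tendsto (fun σ : ℝ => Real.exp (-(σ - 1) * (X + 1)) + T * boundaryTerm F T σ X)
      (𝓝[>] 1) (𝓝 (1 + T * boundaryTerm F T 1 X)) := by
    refine Tendsto.add ?_ ((tendsto_boundaryTerm_nhdsGT hF T X).const_mul T)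
    have h : Continuous fun σ : ℝ => Real.exp (-(σ - 1) * (X + 1)) := by fun_prop
    simpa using (h.tendsto 1).mono_left nhdsWithin_le_nhds
  have h := le_of_tendsto hlim hle
  have hAT : A / T ≤ 1 / 4 := by
    rw [div_le_iff₀ hT0]
    linarith
  have h3 : 1 / 2 ≤ T * ∑ n ∈ natsNearExp ε X, Λ n / n := by
    linarith [(abs_lt.mp hX).1]
  rw [div_le_iff₀ (by positivity)]
  linarith

theorem eventually_sum_vonMangoldt_div_nonprime_lt (ε : ℝ) {c : ℝ} (hc : 0 < c) :
    ∀ᶠ X in atTop, ∑ n ∈ natsNearExp ε X with ¬ n.Prime, Λ n / n < c := by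
  have hs := vonMangoldt.summable_residueClass_non_primes_div (1 : ZMod 1)
  simp only [residueClass_zmod_one] at hs
  obtain ⟨s, hs⟩ := summable_iff_vanishing.mp hs (Set.Iio c) (Iio_mem_nhds hc)
  have hlarge : ∀ᶠ X : ℝ in atTop, ∀ n ∈ s, Real.log n + ε ≤ X :=
    (eventually_all_finset s).mpr fun n _ => eventually_ge_atTop _
  filter_upwards [hlarge] with X hX
  have hdisj : Disjoint ((natsNearExp ε X).filter fun n => ¬ n.Prime) s := by
    refine Finset.disjoint_left.mpr fun n hn hns => ?_
    have h := (abs_lt.mp (Finset.mem_filter.mp (Finset.mem_filter.mp hn).1).2).2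
    linarith [hX n hns]
  refine lt_of_eq_of_lt (Finset.sum_congr rfl fun n hn => ?_) (hs _ hdisj)
  rw [if_neg (Finset.mem_filter.mp hn).2]

theorem eventually_exists_prime_mem_Icc {b : ℝ} (hb : 1 < b) :
    ∀ᶠ x : ℝ in Filter.atTop, ∃ p : ℕ, p.Prime ∧ x ≤ p ∧ p ≤ b * x := by
  set ε := Real.log b / 2 with hε
  have hε0 : 0 < ε := half_pos (Real.log_pos hb)
  obtain ⟨c, hc, hsum⟩ := exists_eventually_le_sum_vonMangoldt_div hε0
  have hnp := eventually_sum_vonMangoldt_div_nonprime_lt ε hc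
  have hX : Tendsto (fun x : ℝ => Real.log x + ε) atTop atTop :=
    tendsto_atTop_add_const_right _ _ Real.tendsto_log_atTop
  filter_upwards [hX.eventually hsum, hX.eventually hnp, eventually_gt_atTop 0] with x h1 h2 hx
  have : ∃ p ∈ natsNearExp ε (Real.log x + ε), p.Prime := by
    by_contra! hno
    rw [Finset.filter_true_of_mem hno] at h2
    linarith
  obtain ⟨p, hp, hpp⟩ := this
  rw [mem_natsNearExp hpp.ne_zero, abs_lt] at hp
  have hp0 : (0 : ℝ) < p := by exact_mod_cast hpp.pos
  refine ⟨p, hpp, ?_, ?_⟩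
  · rw [← Real.log_le_log_iff hx hp0]
    linarith
  · rw [← Real.log_le_log_iff hp0 (by positivity), Real.log_mul (by positivity) hx.ne']
    linarith

end ShortIntervals

section Assembly

open Filter

theorem exists_uniform_bound {k : ℕ} (hk : 2 ≤ k) :
    ∃ n, ∀ (V : Type) [Fintype V] (G : SimpleGraph V), modChromaticIndex k G ≤ n := by
  obtain ⟨p, hp, hprime⟩ := Nat.exists_infinite_primes (k + 2)
  obtain ⟨h, rfl⟩ : ∃ h, p = 2 * h + 1 := hprime.odd_of_ne_two (by omega)
  obtain ⟨d, hd⟩ : ∃ d, k * (12 * h + 3 * k + d) + 1 < 2 ^ (d + 1) := by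
    have h1 := tendsto_pow_const_div_const_pow_of_one_lt 1 (r := (2 : ℝ)) (by norm_num)
    have h2 := tendsto_pow_const_div_const_pow_of_one_lt 0 (r := (2 : ℝ)) (by norm_num)
    have h3 := (h1.const_mul (k : ℝ)).add (h2.const_mul ((k : ℝ) * (12 * h + 3 * k) + 1))
    rw [mul_zero, mul_zero, add_zero] at h3
    obtain ⟨d, hd⟩ := (h3.eventually (gt_mem_nhds (one_pos))).exists
    refine ⟨d, ?_⟩
    have h4 : (0 : ℝ) < 2 ^ d := by positivity
    rw [← mul_div_assoc, ← mul_div_assoc, ← add_div, div_lt_one h4] at hd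
    have h5 : ((k * (12 * h + 3 * k + d) + 1 : ℕ) : ℝ) < ((2 ^ (d + 1) : ℕ) : ℝ) := by
      push_cast
      rw [pow_succ]
      linarith
    exact_mod_cast h5
  refine ⟨12 * h + 3 * k + d + 1, fun V _ G => modChromaticIndex_le G hk (d := d) ?_ hprime ?_ ?_ hd⟩
  all_goals omega

theorem eventually_uniform_bound {ε : ℝ} (hε : 0 < ε) (hε1 : ε ≤ 1) :
    ∀ᶠ k : ℕ in atTop, ∃ n : ℕ, (n : ℝ) ≤ (9 + 7 * ε) * k ∧
      ∀ (V : Type) [Fintype V] (G : SimpleGraph V), modChromaticIndex k G ≤ n := by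
  have hprime := tendsto_natCast_atTop_atTop.eventually
    (eventually_exists_prime_mem_Icc (b := 1 + ε) (by linarith))
  have hr : (1 : ℝ) < 2 ^ ε := Real.one_lt_rpow (by norm_num) hε
  have h1 := tendsto_pow_const_div_const_pow_of_one_lt 2 hr
  have h1' := h1.eventually (gt_mem_nhds (show (0 : ℝ) < 1 / 17 by norm_num))
  filter_upwards [hprime, h1', eventually_ge_atTop 3] with k ⟨p, hp, hkp, hpk⟩ hpow hk
  obtain ⟨h, rfl⟩ : ∃ h, p = 2 * h + 1 := hp.odd_of_ne_two (by
    have : k ≤ p := by exact_mod_cast hkp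
    omega)
  have hkh : k ≤ 2 * h + 1 := by exact_mod_cast hkp
  set d := ⌊ε * k⌋₊ with hd
  have hk0 : (3 : ℝ) ≤ k := by exact_mod_cast hk
  have hdle : (d : ℝ) ≤ ε * k := Nat.floor_le (by positivity)
  have hdlt : ε * k < d + 1 := Nat.lt_floor_add_one _
  push_cast at hpk
  have hεk : ε * k ≤ k := mul_le_of_le_one_left (by positivity) hε1
  refine ⟨(12 * h + 3 * k + d - 3) + 1, ?_, fun V _ G =>
    modChromaticIndex_le G (by omega) (d := d) ?_ hp hkh ?_ ?_⟩
  · have : 12 * h + 3 * k + d - 3 + 1 ≤ 12 * h + 3 * k + d := by omega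
    refine (Nat.cast_le.2 this).trans ?_
    push_cast
    linarith
  · omega
  · omega
  · have h2 : ((12 * h + 3 * k + d - 3 : ℕ) : ℝ) ≤ 16 * k := by
      have : 12 * h + 3 * k + d - 3 ≤ 12 * h + 3 * k + d := by omega
      refine (Nat.cast_le.2 this).trans ?_
      push_cast
      linarith
    have h3 : ((2 : ℝ) ^ ε) ^ k ≤ 2 ^ (d + 1) := by
      rw [← Real.rpow_mul_natCast (by norm_num), ← Real.rpow_natCast]
      refine Real.rpow_le_rpow_of_exponent_le (by norm_num) ?_
      push_cast
      exact hdlt.le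
    have h4 : (0 : ℝ) < (2 ^ ε) ^ k := by positivity
    rw [div_lt_iff₀ h4] at hpow
    have h5 : ((k * (12 * h + 3 * k + d - 3) + 1 : ℕ) : ℝ) < ((2 ^ (d + 1) : ℕ) : ℝ) := by
      push_cast [-Nat.cast_sub]
      have h6 := mul_le_mul_of_nonneg_left h2 (show (0 : ℝ) ≤ k by linarith)
      nlinarith
    exact_mod_cast h5

end Assembly

theorem statement0 :
    ∃ f : ℕ → ℝ, Filter.Tendsto (fun k => f k / k) Filter.atTop (nhds 0) ∧
      ∀ (k : ℕ), 2 ≤ k → ∀ (V : Type) [Fintype V] (G : SimpleGraph V),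
        (modChromaticIndex k G : ℝ) ≤ 9 * (k : ℝ) + f k := by
  let S : ℕ → Set ℕ := fun k =>
    {n | ∀ (V : Type) [Fintype V] (G : SimpleGraph V), modChromaticIndex k G ≤ n}
  refine ⟨fun k => max 0 ((sInf (S k) : ℕ) - 9 * k), ?_, fun k hk V _ G => ?_⟩
  · rw [Metric.tendsto_atTop']
    intro ε hε
    have hε' : 0 < min (ε / 8) 1 := by positivity
    obtain ⟨N, hN⟩ := Filter.eventually_atTop.1 (eventually_uniform_bound hε' (min_le_right _ _))
    refine ⟨N, fun k hk => ?_⟩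
    obtain ⟨n, hn, hnS⟩ := hN k hk.le
    have hk0 : (0 : ℝ) < k := by exact_mod_cast (Nat.zero_le N).trans_lt hk
    have h1 : sInf (S k) ≤ n := Nat.sInf_le hnS
    have h2 : ((sInf (S k) : ℕ) : ℝ) ≤ n := by exact_mod_cast h1
    have h3 : (7 * min (ε / 8) 1) * k ≤ (7 * (ε / 8)) * k := by
      gcongr
      exact min_le_left _ _
    rw [Real.dist_eq, sub_zero, abs_of_nonneg (by positivity), div_lt_iff₀ hk0]
    refine max_lt (by positivity) ?_
    nlinarith
  · have h1 : sInf (S k) ∈ S k := Nat.sInf_mem (exists_uniform_bound hk)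
    have h2 : (modChromaticIndex k G : ℝ) ≤ (sInf (S k) : ℕ) := by exact_mod_cast h1 V G
    have h3 := le_max_right (0 : ℝ) ((sInf (S k) : ℕ) - 9 * k)
    linarith
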